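/- Let F be any field and let k = k(n) ≥ 4 be an integer with k ≤ n/(4·log₂ n). Then the formula ERPHP has a PCR refutation over F of size at most C·k^{k+1}·n^k for an absolute constant C, and there exist a constant c > 0 and an integer n₀ such that for all n ≥ n₀ every PCR refutation of ERPHP over F has size at least c · n^{⌈(k−1)/2⌉} / (k · (16/15)^{⌈(k−1)/2⌉} · (2k·log₂ n)^k). -/

import Mathlib

namespace NarrowProofs

open MvPolynomial

/-- A clause is a finite set of literals; a literal is a variable together with a
sign (`true` = positive literal, `false` = negative literal). -/
abbrev Clause (V : Type) := Finset (V × Bool)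

/-- PCR variables over the variable set `V`: `(v, false)` is the variable `v`
itself and `(v, true)` is its twin `v̄`. -/
abbrev PV (V : Type) := V × Bool

/-- The PCR encoding of a clause (truth is 0, falsity is 1): the clause
`∨_{i∈I} x_i ∨ ∨_{j∈J} ¬x_j` becomes the monomial `∏_{i∈I} x_i · ∏_{j∈J} x̄_j`.
A positive literal `(v, true)` contributes the variable `(v, false)` and a
negative literal `(v, false)` contributes the twin `(v, true)`. -/
noncomputable def encodeClauseMono (K : Type) [CommRing K] {V : Type} [DecidableEq V]
    (C : Clause V) : MvPolynomial (PV V) K :=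
  ∏ l ∈ C, X (l.1, !l.2)

/-- A PCR refutation over a field `K` of a CNF formula `F`: a sequence of
polynomials, each a Boolean axiom `x²−x`, a complementarity axiom `1−x−x̄`,
the encoding of a clause of `F`, a linear combination of two earlier lines, or
a variable multiple of an earlier line, ending with the polynomial `1`. -/
structure PCRRefutation (K : Type) [Field K] (V : Type) [DecidableEq V]
    (F : Set (Clause V)) where
  lines : List (MvPolynomial (PV V) K)
  ne : lines ≠ []
  valid : ∀ (t : ℕ) (p : MvPolynomial (PV V) K), lines[t]? = some p →
    (∃ x : PV V, p = X x ^ 2 - X x) ∨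
    (∃ v : V, p = 1 - X (v, false) - X (v, true)) ∨
    (∃ C ∈ F, p = encodeClauseMono K C) ∨
    (∃ i j : ℕ, i < t ∧ j < t ∧ ∃ (a b : K) (pi pj : MvPolynomial (PV V) K),
      lines[i]? = some pi ∧ lines[j]? = some pj ∧ p = a • pi + b • pj) ∨
    (∃ i : ℕ, i < t ∧ ∃ (x : PV V) (pi : MvPolynomial (PV V) K),
      lines[i]? = some pi ∧ p = X x * pi)
  last_one : lines.getLast ne = 1

/-- The size of a PCR refutation: the total number of monomials (with nonzero
coefficient) in its polynomials. -/
noncomputable def PCRRefutation.size {K : Type} [Field K] {V : Type} [DecidableEq V]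
    {F : Set (Clause V)} (π : PCRRefutation K V F) : ℕ :=
  (π.lines.map (fun p => p.support.card)).sum

/-- The variables of the 3-CNF relativized pigeonhole principle `ERPHP`. -/
inductive ERVar where
  | p (u v : ℕ)
  | q (v w : ℕ)
  | r (v : ℕ)
  | rr (v v' : ℕ)
  | y (u v : ℕ)
  | z (v w : ℕ)
deriving DecidableEq

/-- The 3-CNF relativized pigeonhole principle formula with `k` pigeons chosen
among `n` and `k-1` holes (all indices are 1-based). -/
def ERPHP (n k : ℕ) : Set (Clause ERVar) :=
  { C |
    (∃ u, 1 ≤ u ∧ u ≤ k ∧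
      C = {(ERVar.p u 1, true), (ERVar.p u 2, true), (ERVar.y u 2, true)}) ∨
    (∃ u v, 1 ≤ u ∧ u ≤ k ∧ 2 ≤ v ∧ v ≤ n - 3 ∧
      C = {(ERVar.y u v, false), (ERVar.p u (v+1), true), (ERVar.y u (v+1), true)}) ∨
    (∃ u, 1 ≤ u ∧ u ≤ k ∧
      C = {(ERVar.y u (n-2), false), (ERVar.p u (n-1), true), (ERVar.p u n, true)}) ∨
    (∃ v, 1 ≤ v ∧ v ≤ n ∧
      C = {(ERVar.r v, false), (ERVar.q v 1, true), (ERVar.z v 1, true)}) ∨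
    (∃ v w, 1 ≤ v ∧ v ≤ n ∧ 1 ≤ w ∧ w ≤ k - 4 ∧
      C = {(ERVar.z v w, false), (ERVar.q v (w+1), true), (ERVar.z v (w+1), true)}) ∨
    (∃ v, 1 ≤ v ∧ v ≤ n ∧
      C = {(ERVar.z v (k-3), false), (ERVar.q v (k-2), true), (ERVar.q v (k-1), true)}) ∨
    (∃ u u' v, 1 ≤ u ∧ u ≤ k ∧ 1 ≤ u' ∧ u' ≤ k ∧ u ≠ u' ∧ 1 ≤ v ∧ v ≤ n ∧
      C = {(ERVar.p u v, false), (ERVar.p u' v, false)}) ∨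
    (∃ u v, 1 ≤ u ∧ u ≤ k ∧ 1 ≤ v ∧ v ≤ n ∧
      C = {(ERVar.p u v, false), (ERVar.r v, true)}) ∨
    (∃ v v', 1 ≤ v ∧ v ≤ n ∧ 1 ≤ v' ∧ v' ≤ n ∧ v ≠ v' ∧
      C = {(ERVar.r v, false), (ERVar.r v', false), (ERVar.rr v v', true)}) ∨
    (∃ v v' w, 1 ≤ v ∧ v ≤ n ∧ 1 ≤ v' ∧ v' ≤ n ∧ v ≠ v' ∧ 1 ≤ w ∧ w ≤ k - 1 ∧
      C = {(ERVar.rr v v', false), (ERVar.q v w, false), (ERVar.q v' w, false)}) }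


section Upper

/-- The condition for a single line of a PCR derivation. -/
def StepOK (K : Type) [Field K] (F : Set (Clause ERVar)) (L : List (MvPolynomial (PV ERVar) K))
    (t : ℕ) (p : MvPolynomial (PV ERVar) K) : Prop :=
    (∃ x : PV ERVar, p = X x ^ 2 - X x) ∨
    (∃ v : ERVar, p = 1 - X (v, false) - X (v, true)) ∨
    (∃ C ∈ F, p = encodeClauseMono K C) ∨
    (∃ i j : ℕ, i < t ∧ j < t ∧ ∃ (a b : K) (pi pj : MvPolynomial (PV ERVar) K),
      L[i]? = some pi ∧ L[j]? = some pj ∧ p = a • pi + b • pj) ∨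
    (∃ i : ℕ, i < t ∧ ∃ (x : PV ERVar) (pi : MvPolynomial (PV ERVar) K),
      L[i]? = some pi ∧ p = X x * pi)

/-- Tree-like derivations with a cost bound. -/
inductive Der (K : Type) [Field K] (F : Set (Clause ERVar)) :
    MvPolynomial (PV ERVar) K → ℕ → Prop
  | compl (v : ERVar) (e : ℕ)
      (h : (1 - X (v, false) - X (v, true) : MvPolynomial (PV ERVar) K).support.card ≤ e) :
      Der K F (1 - X (v, false) - X (v, true)) e
  | clause (C : Clause ERVar) (hC : C ∈ F) (e : ℕ) (h : (encodeClauseMono K C).support.card ≤ e) :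
      Der K F (encodeClauseMono K C) e
  | lin (p q : MvPolynomial (PV ERVar) K) (c d : ℕ) (a b : K) (e : ℕ) (hp : Der K F p c)
      (hq : Der K F q d) (h : (a • p + b • q).support.card ≤ e) :
      Der K F (a • p + b • q) (c + d + e)
  | mul (p : MvPolynomial (PV ERVar) K) (c : ℕ) (x : PV ERVar) (e : ℕ) (hp : Der K F p c)
      (h : (X x * p).support.card ≤ e) : Der K F (X x * p) (c + e)

variable {K : Type} [Field K] {F : Set (Clause ERVar)}

lemma StepOK.append_left {L1 L2 : List (MvPolynomial (PV ERVar) K)} {t : ℕ}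
    {p : MvPolynomial (PV ERVar) K} (h : StepOK K F L1 t p) (ht : t ≤ L1.length) :
    StepOK K F (L1 ++ L2) t p := by
  rcases h with h | h | h | ⟨i, j, hi, hj, a, b, pi, pj, h1, h2, h3⟩ | ⟨i, hi, x, pi, h1, h2⟩
  · exact Or.inl h
  · exact Or.inr (Or.inl h)
  · exact Or.inr (Or.inr (Or.inl h))
  · refine Or.inr (Or.inr (Or.inr (Or.inl ⟨i, j, hi, hj, a, b, pi, pj, ?_, ?_, h3⟩)))
    · rw [List.getElem?_append_left (by omega)]; exact h1
    · rw [List.getElem?_append_left (by omega)]; exact h2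
  · refine Or.inr (Or.inr (Or.inr (Or.inr ⟨i, hi, x, pi, ?_, h2⟩)))
    rw [List.getElem?_append_left (by omega)]; exact h1

lemma StepOK.append_right {L1 L2 : List (MvPolynomial (PV ERVar) K)} {t : ℕ}
    {p : MvPolynomial (PV ERVar) K} (h : StepOK K F L2 t p) :
    StepOK K F (L1 ++ L2) (L1.length + t) p := by
  rcases h with h | h | h | ⟨i, j, hi, hj, a, b, pi, pj, h1, h2, h3⟩ | ⟨i, hi, x, pi, h1, h2⟩
  · exact Or.inl h
  · exact Or.inr (Or.inl h)
  · exact Or.inr (Or.inr (Or.inl h))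
  · refine Or.inr (Or.inr (Or.inr (Or.inl ⟨L1.length + i, L1.length + j, by omega, by omega,
      a, b, pi, pj, ?_, ?_, h3⟩)))
    · rw [List.getElem?_append_right (by omega)]; simpa using h1
    · rw [List.getElem?_append_right (by omega)]; simpa using h2
  · refine Or.inr (Or.inr (Or.inr (Or.inr ⟨L1.length + i, by omega, x, pi, ?_, h2⟩)))
    rw [List.getElem?_append_right (by omega)]; simpa using h1

def ValidList (K : Type) [Field K] (F : Set (Clause ERVar))
    (L : List (MvPolynomial (PV ERVar) K)) : Prop :=
  ∀ t p, L[t]? = some p → StepOK K F L t p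

lemma ValidList.append {L1 L2 : List (MvPolynomial (PV ERVar) K)} (h1 : ValidList K F L1)
    (h2 : ValidList K F L2) : ValidList K F (L1 ++ L2) := by
  intro t p hp
  by_cases ht : t < L1.length
  · rw [List.getElem?_append_left ht] at hp
    exact (h1 t p hp).append_left ht.le
  · rw [List.getElem?_append_right (by omega)] at hp
    have := (h2 _ p hp).append_right (L1 := L1)
    rwa [Nat.add_sub_cancel' (by omega)] at this

lemma ValidList.snoc {L : List (MvPolynomial (PV ERVar) K)} (h1 : ValidList K F L)
    {p : MvPolynomial (PV ERVar) K} (h2 : StepOK K F L L.length p) :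
    ValidList K F (L ++ [p]) := by
  intro t q hq
  by_cases ht : t < L.length
  · rw [List.getElem?_append_left ht] at hq
    exact (h1 t q hq).append_left ht.le
  · rw [List.getElem?_append_right (by omega)] at hq
    have ht' : t = L.length := by
      by_contra hne
      rw [List.getElem?_eq_none (by simp; omega)] at hq
      simp at hq
    subst ht'
    simp at hq
    subst hq
    exact h2.append_left le_rfl

noncomputable def lsize (L : List (MvPolynomial (PV ERVar) K)) : ℕ :=
  (L.map (fun p => p.support.card)).sum

lemma Der.exists_list {p : MvPolynomial (PV ERVar) K} {c : ℕ} (h : Der K F p c) :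
    ∃ L : List (MvPolynomial (PV ERVar) K), ValidList K F (L ++ [p]) ∧ lsize (L ++ [p]) ≤ c := by
  induction h with
  | compl v e h =>
    refine ⟨[], ValidList.snoc (by intro t p; simp) (Or.inr (Or.inl ⟨v, rfl⟩)), by simpa [lsize] using h⟩
  | clause C hC e h =>
    refine ⟨[], ValidList.snoc (by intro t p; simp) (Or.inr (Or.inr (Or.inl ⟨C, hC, rfl⟩))),
      by simpa [lsize] using h⟩
  | lin p q c d a b e hp hq h ih1 ih2 =>
    obtain ⟨L1, hv1, hs1⟩ := ih1
    obtain ⟨L2, hv2, hs2⟩ := ih2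
    refine ⟨(L1 ++ [p]) ++ (L2 ++ [q]), (hv1.append hv2).snoc ?_, ?_⟩
    · refine Or.inr (Or.inr (Or.inr (Or.inl ⟨L1.length, L1.length + 1 + L2.length, by simp,
        by simp; omega, a, b, p, q, ?_, ?_, rfl⟩)))
      · rw [List.getElem?_append_left (by simp)]; simp
      · rw [List.getElem?_append_right (by simp)]; simp
    · simp only [lsize, List.map_append, List.sum_append, List.map_cons, List.map_nil,
        List.sum_cons, List.sum_nil] at *
      omega
  | mul p c x e hp h ih =>
    obtain ⟨L1, hv1, hs1⟩ := ih
    refine ⟨(L1 ++ [p]), hv1.snoc ?_, ?_⟩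
    · refine Or.inr (Or.inr (Or.inr (Or.inr ⟨L1.length, by simp, x, p, ?_, rfl⟩)))
      simp
    · simp only [lsize, List.map_append, List.sum_append, List.map_cons, List.map_nil,
        List.sum_cons, List.sum_nil] at *
      omega

lemma Der.refutation {c : ℕ} (h : Der K F 1 c) :
    ∃ π : PCRRefutation K ERVar F, π.size ≤ c := by
  obtain ⟨L, hv, hs⟩ := h.exists_list
  exact ⟨⟨L ++ [1], by simp, hv, by simp⟩, hs⟩

lemma Der.mono {p : MvPolynomial (PV ERVar) K} {c d : ℕ} (h : Der K F p c) (hcd : c ≤ d) :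
    Der K F p d := by
  obtain ⟨e, rfl⟩ := Nat.exists_eq_add_of_le hcd
  cases h with
  | compl v _ h => exact Der.compl v _ (by omega)
  | clause C hC _ h => exact Der.clause C hC _ (by omega)
  | lin p q c d a b e' hp hq h =>
    have := Der.lin p q c d a b (e' + e) hp hq (by omega)
    rwa [← add_assoc] at this
  | mul p c x e' hp h =>
    have := Der.mul p c x (e' + e) hp (by omega)
    rwa [← add_assoc] at this

/-- Monomials as products of multisets of variables. -/
noncomputable def mon (K : Type) [Field K] (S : Multiset (PV ERVar)) : MvPolynomial (PV ERVar) K :=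
  (S.map X).prod

lemma mon_cons (x : PV ERVar) (S : Multiset (PV ERVar)) : mon K (x ::ₘ S) = X x * mon K S := by
  simp [mon]

lemma mon_eq (S : Multiset (PV ERVar)) : ∃ s, mon K S = monomial s 1 := by
  induction S using Multiset.induction_on with
  | empty => exact ⟨0, by simp [mon]⟩
  | cons a S ih =>
    obtain ⟨s, hs⟩ := ih
    exact ⟨Finsupp.single a 1 + s, by rw [mon_cons, hs, X, monomial_mul]; simp⟩

lemma card_mon (S : Multiset (PV ERVar)) : (mon K S).support.card ≤ 1 := by
  obtain ⟨s, hs⟩ := mon_eq (K := K) S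
  rw [hs]
  exact (Finset.card_le_card support_monomial_subset).trans (by simp)

lemma Der.weaken {A B : Multiset (PV ERVar)} {c : ℕ} (h : Der K F (mon K A) c) (hAB : A ≤ B) :
    Der K F (mon K B) (c + B.card) := by
  obtain ⟨T, rfl⟩ := Multiset.le_iff_exists_add.1 hAB
  have key : Der K F (mon K (A + T)) (c + T.card) := by
    clear hAB
    induction T using Multiset.induction_on with
    | empty => simpa using h
    | cons a T ih =>
      have := Der.mul _ _ a 1 ih (by rw [← mon_cons]; exact card_mon _)
      rw [← mon_cons] at this
      rw [Multiset.add_cons, Multiset.card_cons, ← add_assoc]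
      exact this
  exact key.mono (by simp)

lemma encode_eq_mon (C : Clause ERVar) :
    encodeClauseMono K C = mon K (C.1.map (fun l => (l.1, !l.2))) := by
  unfold encodeClauseMono mon
  rw [Multiset.map_map]; rfl

lemma Der.cl {C : Clause ERVar} (hC : C ∈ F) {S : Multiset (PV ERVar)}
    (hS : C.1.map (fun l => (l.1, !l.2)) ≤ S) : Der K F (mon K S) (1 + S.card) := by
  have h : Der K F (mon K (C.1.map (fun l => (l.1, !l.2)))) 1 := by
    rw [← encode_eq_mon]
    exact Der.clause C hC 1 (by rw [encode_eq_mon]; exact card_mon _)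
  exact h.weaken hS

lemma Der.compl_mul (v : ERVar) (S : Multiset (PV ERVar)) :
    Der K F (mon K S - mon K ((v, false) ::ₘ S) - mon K ((v, true) ::ₘ S)) (3 * S.card + 3) := by
  have card3 : ∀ S : Multiset (PV ERVar),
      (mon K S - mon K ((v, false) ::ₘ S) - mon K ((v, true) ::ₘ S)).support.card ≤ 3 := by
    intro S
    refine (Finset.card_le_card (support_sub _ _ _)).trans
      ((Finset.card_union_le _ _).trans ?_)
    have h1 := (Finset.card_le_card (support_sub _ (mon K S) (mon K ((v, false) ::ₘ S)))).trans
      (Finset.card_union_le _ _)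
    have := card_mon (K := K) S
    have := card_mon (K := K) ((v, false) ::ₘ S)
    have := card_mon (K := K) ((v, true) ::ₘ S)
    omega
  induction S using Multiset.induction_on with
  | empty =>
    have := card3 0
    simp only [mon_cons] at this ⊢
    simp only [mon, Multiset.map_zero, Multiset.prod_zero, mul_one] at this ⊢
    exact Der.compl v _ (by simpa using this)
  | cons a S ih =>
    have e : X a * (mon K S - mon K ((v, false) ::ₘ S) - mon K ((v, true) ::ₘ S)) =
      mon K (a ::ₘ S) - mon K ((v, false) ::ₘ a ::ₘ S) - mon K ((v, true) ::ₘ a ::ₘ S) := by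
      simp only [mon_cons]; ring
    have := Der.mul _ _ a 3 ih (by rw [e]; exact card3 _)
    rw [e] at this
    exact this.mono (by simp; omega)

/-- The resolution rule. -/
lemma Der.res (x : ERVar) {A B S : Multiset (PV ERVar)} {c1 c2 : ℕ} (h1 : Der K F (mon K A) c1)
    (h2 : Der K F (mon K B) c2) (hA : A ≤ (x, false) ::ₘ S) (hB : B ≤ (x, true) ::ₘ S) :
    Der K F (mon K S) (c1 + c2 + 5 * S.card + 8) := by
  have g1 := h1.weaken hA
  have g2 := h2.weaken hB
  have g3 := Der.compl_mul (K := K) (F := F) x S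
  have g4 := Der.lin _ _ _ _ 1 1 2 g1 g2 (by
    simp only [one_smul]
    refine (Finset.card_le_card support_add).trans ((Finset.card_union_le _ _).trans ?_)
    have := card_mon (K := K) ((x, false) ::ₘ S)
    have := card_mon (K := K) ((x, true) ::ₘ S)
    omega)
  have e : (1 : K) • ((1 : K) • mon K ((x, false) ::ₘ S) + (1 : K) • mon K ((x, true) ::ₘ S)) +
      (1 : K) • (mon K S - mon K ((x, false) ::ₘ S) - mon K ((x, true) ::ₘ S)) = mon K S := by
    simp only [one_smul]; ring
  have g5 := Der.lin _ _ _ _ 1 1 1 g4 g3 (by rw [e]; exact card_mon _)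
  rw [e] at g5
  exact g5.mono (by simp; omega)

lemma ndinsert_le_cons' (a : ERVar × Bool) (s : Multiset (ERVar × Bool)) :
    Multiset.ndinsert a s ≤ a ::ₘ s :=
  Multiset.ndinsert_le.2 ⟨Multiset.le_cons_self _ _, Multiset.mem_cons_self _ _⟩

lemma enc3_le (a b c : ERVar × Bool) :
    ({a, b, c} : Clause ERVar).1.map (fun l => (l.1, !l.2)) ≤
      {(a.1, !a.2), (b.1, !b.2), (c.1, !c.2)} := by
  have : ({a, b, c} : Clause ERVar).1 ≤ {a, b, c} := by
    simp only [Finset.insert_val, Finset.singleton_val, Multiset.insert_eq_cons]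
    refine (ndinsert_le_cons' _ _).trans ?_
    exact Multiset.cons_le_cons _ (ndinsert_le_cons' _ _)
  simpa using Multiset.map_le_map this

lemma enc2_le (a b : ERVar × Bool) :
    ({a, b} : Clause ERVar).1.map (fun l => (l.1, !l.2)) ≤ {(a.1, !a.2), (b.1, !b.2)} := by
  have : ({a, b} : Clause ERVar).1 ≤ {a, b} := by
    simp only [Finset.insert_val, Finset.singleton_val, Multiset.insert_eq_cons]
    exact (ndinsert_le_cons' _ _)
  simpa using Multiset.map_le_map this

end Upper

section Upper2

variable {K : Type} [Field K] {F : Set (Clause ERVar)}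

lemma Der.cl3 {a b c : ERVar × Bool} (hC : ({a, b, c} : Clause ERVar) ∈ F) :
    Der K F (mon K {(a.1, !a.2), (b.1, !b.2), (c.1, !c.2)}) 4 :=
  Der.cl hC (enc3_le a b c)

lemma Der.cl2 {a b : ERVar × Bool} (hC : ({a, b} : Clause ERVar) ∈ F) :
    Der K F (mon K {(a.1, !a.2), (b.1, !b.2)}) 3 :=
  Der.cl hC (enc2_le a b)

lemma le_of_add_eq {A B : Multiset (PV ERVar)} (C : Multiset (PV ERVar)) (h : B = A + C) : A ≤ B :=
  Multiset.le_iff_exists_add.2 ⟨C, h⟩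

lemma chain_step {x Y : ℕ → ERVar} {i : ℕ} {S : Multiset (PV ERVar)} {c d : ℕ}
    (h : Der K F (mon K ((Y i, false) ::ₘ S)) c)
    (hC : ({(Y i, false), (x (i + 1), true), (Y (i + 1), true)} : Clause ERVar) ∈ F)
    (hx : Der K F (mon K ((x (i + 1), true) ::ₘ S)) d) :
    Der K F (mon K ((Y (i + 1), false) ::ₘ S)) (c + (d + 10 * S.card + 35)) := by
  have h1 := Der.cl3 (K := K) hC
  have h2 := Der.res (Y i) (S := (x (i + 1), false) ::ₘ (Y (i + 1), false) ::ₘ S) h h1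
    (le_of_add_eq {(x (i + 1), false), (Y (i + 1), false)}
      (by simp only [← Multiset.singleton_add, Multiset.insert_eq_cons]; abel))
    (le_of_add_eq S (by
      simp only [← Multiset.singleton_add, Multiset.insert_eq_cons, Bool.not_true, Bool.not_false]; abel))
  have h3 := Der.res (x (i + 1)) (S := (Y (i + 1), false) ::ₘ S) h2 hx le_rfl
    (le_of_add_eq {(Y (i + 1), false)}
      (by simp only [← Multiset.singleton_add]; abel))
  exact h3.mono (by simp; omega)

lemma chain_steps {x Y : ℕ → ERVar} {a : ℕ} {S : Multiset (PV ERVar)} {c d : ℕ} (m : ℕ)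
    (h : Der K F (mon K ((Y a, false) ::ₘ S)) c)
    (hC : ∀ i, a ≤ i → i < a + m →
      ({(Y i, false), (x (i + 1), true), (Y (i + 1), true)} : Clause ERVar) ∈ F)
    (hx : ∀ i, a ≤ i → i < a + m → Der K F (mon K ((x (i + 1), true) ::ₘ S)) d) :
    Der K F (mon K ((Y (a + m), false) ::ₘ S)) (c + m * (d + 10 * S.card + 35)) := by
  induction m with
  | zero => simpa using h
  | succ m ih =>
    have := chain_step (ih (fun i h1 h2 => hC i h1 (by omega)) (fun i h1 h2 => hx i h1 (by omega)))
      (hC (a + m) (by omega) (by omega)) (hx (a + m) (by omega) (by omega))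
    exact this.mono (by rw [Nat.add_mul]; omega)

lemma chain_final {Y x1 x2 : ERVar} {S : Multiset (PV ERVar)} {c d : ℕ}
    (h : Der K F (mon K ((Y, false) ::ₘ S)) c)
    (hC : ({(Y, false), (x1, true), (x2, true)} : Clause ERVar) ∈ F)
    (hx1 : Der K F (mon K ((x1, true) ::ₘ S)) d)
    (hx2 : Der K F (mon K ((x2, true) ::ₘ S)) d) :
    Der K F (mon K S) (c + 2 * d + 15 * S.card + 43) := by
  have h1 := Der.cl3 (K := K) hC
  have h2 := Der.res Y (S := (x1, false) ::ₘ (x2, false) ::ₘ S) h h1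
    (le_of_add_eq {(x1, false), (x2, false)}
      (by simp only [← Multiset.singleton_add, Multiset.insert_eq_cons]; abel))
    (le_of_add_eq S (by
      simp only [← Multiset.singleton_add, Multiset.insert_eq_cons, Bool.not_true, Bool.not_false]; abel))
  have h3 := Der.res x1 (S := (x2, false) ::ₘ S) h2 hx1 le_rfl
    (le_of_add_eq {(x2, false)} (by simp only [← Multiset.singleton_add]; abel))
  have h4 := Der.res x2 (S := S) h3 hx2 le_rfl le_rfl
  exact h4.mono (by simp; omega)

lemma branchP {n k u : ℕ} (hn : 4 ≤ n) (hu1 : 1 ≤ u) (huk : u ≤ k) {S : Multiset (PV ERVar)} {d : ℕ}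
    (hx : ∀ v, 1 ≤ v → v ≤ n → Der K (ERPHP n k) (mon K ((ERVar.p u v, true) ::ₘ S)) d) :
    Der K (ERPHP n k) (mon K S) (n * (d + 15 * S.card + 45)) := by
  have c1 : ({(ERVar.p u 1, true), (ERVar.p u 2, true), (ERVar.y u 2, true)} : Clause ERVar) ∈
      ERPHP n k := Or.inl ⟨u, hu1, huk, rfl⟩
  have h1 := Der.cl3 (K := K) c1
  have h2 := Der.res (ERVar.p u 1) (S := (ERVar.p u 2, false) ::ₘ (ERVar.y u 2, false) ::ₘ S) h1
    (hx 1 le_rfl (by omega))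
    (le_of_add_eq S (by
      simp only [← Multiset.singleton_add, Multiset.insert_eq_cons, Bool.not_true]; abel))
    (le_of_add_eq {(ERVar.p u 2, false), (ERVar.y u 2, false)}
      (by simp only [← Multiset.singleton_add, Multiset.insert_eq_cons]; abel))
  have h3 := Der.res (ERVar.p u 2) (S := (ERVar.y u 2, false) ::ₘ S) h2 (hx 2 (by omega) (by omega))
    le_rfl (le_of_add_eq {(ERVar.y u 2, false)} (by simp only [← Multiset.singleton_add]; abel))
  have h4 := chain_steps (x := ERVar.p u) (Y := ERVar.y u) (n - 4) h3
    (fun i h1 h2 => Or.inr (Or.inl ⟨u, i, hu1, huk, h1, by omega, rfl⟩))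
    (fun i h1 h2 => hx (i + 1) (by omega) (by omega))
  rw [show 2 + (n - 4) = n - 2 by omega] at h4
  have h5 := chain_final h4 (Or.inr (Or.inr (Or.inl ⟨u, hu1, huk, rfl⟩)))
    (hx (n - 1) (by omega) (by omega)) (hx n (by omega) (by omega))
  refine h5.mono ?_
  obtain ⟨m, rfl⟩ := Nat.exists_eq_add_of_le hn
  simp only [Multiset.card_cons, Nat.add_sub_cancel_left]
  nlinarith [Nat.zero_le (m * S.card), Nat.zero_le m]

lemma branchQ {n k u v : ℕ} (hk : 4 ≤ k) (hu1 : 1 ≤ u) (huk : u ≤ k) (hv1 : 1 ≤ v) (hvn : v ≤ n)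
    {S : Multiset (PV ERVar)} {d : ℕ} (hS : (ERVar.p u v, true) ∈ S)
    (hx : ∀ w, 1 ≤ w → w ≤ k - 1 → Der K (ERPHP n k) (mon K ((ERVar.q v w, true) ::ₘ S)) d) :
    Der K (ERPHP n k) (mon K S) ((k - 1) * (d + 15 * S.card + 45)) := by
  have c1 : ({(ERVar.r v, false), (ERVar.q v 1, true), (ERVar.z v 1, true)} : Clause ERVar) ∈
      ERPHP n k := Or.inr (Or.inr (Or.inr (Or.inl ⟨v, hv1, hvn, rfl⟩)))
  have c2 : ({(ERVar.p u v, false), (ERVar.r v, true)} : Clause ERVar) ∈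
      ERPHP n k := Or.inr (Or.inr (Or.inr (Or.inr (Or.inr (Or.inr (Or.inr (Or.inl
        ⟨u, v, hu1, huk, hv1, hvn, rfl⟩)))))))
  have h1 := Der.cl3 (K := K) c1
  have h0 := Der.cl2 (K := K) c2
  obtain ⟨S', rfl⟩ := Multiset.exists_cons_of_mem hS
  set S := (ERVar.p u v, true) ::ₘ S' with hSdef
  have h2 := Der.res (ERVar.r v) (S := (ERVar.q v 1, false) ::ₘ (ERVar.z v 1, false) ::ₘ S) h0 h1
    (le_of_add_eq ((ERVar.q v 1, false) ::ₘ (ERVar.z v 1, false) ::ₘ S')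
      (by simp only [hSdef, ← Multiset.singleton_add, Multiset.insert_eq_cons, Bool.not_true,
            Bool.not_false]; abel))
    (le_of_add_eq S (by
      simp only [← Multiset.singleton_add, Multiset.insert_eq_cons, Bool.not_true, Bool.not_false]; abel))
  have h3 := Der.res (ERVar.q v 1) (S := (ERVar.z v 1, false) ::ₘ S) h2 (hx 1 (by omega) (by omega))
    le_rfl (le_of_add_eq {(ERVar.z v 1, false)} (by simp only [← Multiset.singleton_add]; abel))
  have h4 := chain_steps (x := ERVar.q v) (Y := ERVar.z v) (k - 4) h3
    (fun i h1 h2 => Or.inr (Or.inr (Or.inr (Or.inr (Or.inl ⟨v, i, hv1, hvn, h1, by omega, rfl⟩)))))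
    (fun i h1 h2 => hx (i + 1) (by omega) (by omega))
  rw [show 1 + (k - 4) = k - 3 by omega] at h4
  have h5 := chain_final h4 (Or.inr (Or.inr (Or.inr (Or.inr (Or.inr (Or.inl ⟨v, hv1, hvn, rfl⟩))))))
    (hx (k - 2) (by omega) (by omega)) (hx (k - 1) (by omega) (by omega))
  refine h5.mono ?_
  obtain ⟨m, rfl⟩ := Nat.exists_eq_add_of_le hk
  simp only [Multiset.card_cons, Nat.add_sub_cancel_left, show 4 + m - 1 = 3 + m by omega]
  nlinarith [Nat.zero_le (m * S.card), Nat.zero_le m]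

/-- The node multiset after choosing `v_1, …, v_i`. -/
def nodeP (v : ℕ → ℕ) : ℕ → Multiset (PV ERVar)
  | 0 => 0
  | i + 1 => (ERVar.p (i + 1) (v (i + 1)), true) ::ₘ nodeP v i

/-- The node multiset after choosing in addition `w_1, …, w_j`. -/
def nodeQ (v w : ℕ → ℕ) : ℕ → Multiset (PV ERVar)
  | 0 => 0
  | j + 1 => (ERVar.q (v (j + 1)) (w (j + 1)), true) ::ₘ nodeQ v w j

lemma card_nodeP (v : ℕ → ℕ) (i : ℕ) : (nodeP v i).card = i := by
  induction i with
  | zero => rfl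
  | succ i ih => simp [nodeP, ih]

lemma card_nodeQ (v w : ℕ → ℕ) (i : ℕ) : (nodeQ v w i).card = i := by
  induction i with
  | zero => rfl
  | succ i ih => simp [nodeQ, ih]

lemma nodeP_congr {v v' : ℕ → ℕ} {i : ℕ} (h : ∀ u ≤ i, v u = v' u) : nodeP v i = nodeP v' i := by
  induction i with
  | zero => rfl
  | succ i ih => simp [nodeP, ih (fun u hu => h u (by omega)), h (i + 1) le_rfl]

lemma nodeQ_congr {v w w' : ℕ → ℕ} {i : ℕ} (h : ∀ u ≤ i, w u = w' u) :
    nodeQ v w i = nodeQ v w' i := by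
  induction i with
  | zero => rfl
  | succ i ih => simp [nodeQ, ih (fun u hu => h u (by omega)), h (i + 1) le_rfl]

lemma mem_nodeP {v : ℕ → ℕ} {i u : ℕ} (h1 : 1 ≤ u) (h2 : u ≤ i) :
    (ERVar.p u (v u), true) ∈ nodeP v i := by
  induction i with
  | zero => omega
  | succ i ih =>
    rcases Nat.lt_or_ge i u with h | h
    · obtain rfl : u = i + 1 := by omega
      simp [nodeP]
    · simp [nodeP, ih h]

lemma pair_le_nodeP {v : ℕ → ℕ} {i u u' : ℕ} (h1 : 1 ≤ u) (h2 : u < u') (h3 : u' ≤ i) :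
    ({(ERVar.p u (v u), true), (ERVar.p u' (v u'), true)} : Multiset (PV ERVar)) ≤ nodeP v i := by
  rw [Multiset.le_iff_subset (by simp; omega)]
  intro a ha
  simp only [Multiset.insert_eq_cons, Multiset.mem_cons, Multiset.mem_singleton] at ha
  rcases ha with rfl | rfl
  · exact mem_nodeP h1 (by omega)
  · exact mem_nodeP (by omega) h3

lemma pair_le_nodeQ {v w : ℕ → ℕ} {i u u' : ℕ} (h1 : 1 ≤ u) (h2 : u < u') (h3 : u' ≤ i) :
    ({(ERVar.q (v u) (w u), true), (ERVar.q (v u') (w u'), true)} : Multiset (PV ERVar))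
      ≤ nodeQ v w i := by
  induction i with
  | zero => omega
  | succ i ih =>
    rcases Nat.lt_or_ge i u' with h | h
    · obtain rfl : u' = i + 1 := by omega
      rw [nodeQ, Multiset.insert_eq_cons, ← Multiset.cons_zero, Multiset.cons_swap, Multiset.cons_zero]
      refine Multiset.cons_le_cons _ (Multiset.singleton_le.2 ?_)
      clear ih h3 h
      have h2' : u ≤ i := by omega
      clear h2
      induction i with
      | zero => omega
      | succ i ih =>
        rcases Nat.lt_or_ge i u with h | h
        · obtain rfl : u = i + 1 := by omega
          simp [nodeQ]
        · rw [nodeQ]; exact Multiset.mem_cons_of_mem (ih h)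
    · exact (ih h).trans (Multiset.le_cons_self _ _)

lemma leafDer {n k : ℕ} (hk : 4 ≤ k) {v w : ℕ → ℕ} (hv : ∀ u, 1 ≤ u → u ≤ k → 1 ≤ v u ∧ v u ≤ n)
    (hw : ∀ u, 1 ≤ u → u ≤ k → 1 ≤ w u ∧ w u ≤ k - 1) :
    Der K (ERPHP n k) (mon K (nodeQ v w k + nodeP v k)) (27 * k) := by
  obtain ⟨a, ha1, hak, b, hb1, hbk, hab, hwab⟩ : ∃ a, 1 ≤ a ∧ a ≤ k ∧ ∃ b, 1 ≤ b ∧ b ≤ k ∧ a < b ∧ w a = w b := by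
    obtain ⟨a, ha, b, hb, hne, h⟩ := Finset.exists_ne_map_eq_of_card_lt_of_maps_to
      (s := Finset.Icc 1 k) (t := Finset.Icc 1 (k - 1)) (f := w) (by simp; omega)
      (by intro u hu; simp at hu ⊢; exact hw u hu.1 hu.2)
    simp only [Finset.mem_Icc] at ha hb
    rcases lt_or_gt_of_ne hne with h' | h'
    · exact ⟨a, ha.1, ha.2, b, hb.1, hb.2, h', h⟩
    · exact ⟨b, hb.1, hb.2, a, ha.1, ha.2, h', h.symm⟩
  have hPle := pair_le_nodeP (v := v) ha1 hab hbk
  have hQle := pair_le_nodeQ (v := v) (w := w) ha1 hab hbk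
  have hcard : (nodeQ v w k + nodeP v k).card = 2 * k := by
    rw [Multiset.card_add, card_nodeP, card_nodeQ]; ring
  by_cases hvab : v a = v b
  · have c1 : ({(ERVar.p a (v a), false), (ERVar.p b (v b), false)} : Clause ERVar) ∈ ERPHP n k := by
      rw [hvab]
      exact Or.inr (Or.inr (Or.inr (Or.inr (Or.inr (Or.inr (Or.inl
        ⟨a, b, v b, ha1, hak, hb1, hbk, hab.ne, (hv b hb1 hbk).1, (hv b hb1 hbk).2, rfl⟩))))))
    have h1 := (Der.cl2 (K := K) c1).weaken (hPle.trans (Multiset.le_add_left _ (nodeQ v w k)))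
    exact h1.mono (by omega)
  · have hva := hv a ha1 hak
    have hvb := hv b hb1 hbk
    have hwa := hw a ha1 hak
    have c1 : ({(ERVar.r (v a), false), (ERVar.r (v b), false), (ERVar.rr (v a) (v b), true)} :
        Clause ERVar) ∈ ERPHP n k :=
      Or.inr (Or.inr (Or.inr (Or.inr (Or.inr (Or.inr (Or.inr (Or.inr (Or.inl
        ⟨v a, v b, hva.1, hva.2, hvb.1, hvb.2, hvab, rfl⟩))))))))
    have c2 : ({(ERVar.rr (v a) (v b), false), (ERVar.q (v a) (w a), false),
        (ERVar.q (v b) (w b), false)} : Clause ERVar) ∈ ERPHP n k :=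
      Or.inr (Or.inr (Or.inr (Or.inr (Or.inr (Or.inr (Or.inr (Or.inr (Or.inr
        ⟨v a, v b, w a, hva.1, hva.2, hvb.1, hvb.2, hvab, hwa.1, hwa.2, by rw [hwab]⟩))))))))
    have c3 : ({(ERVar.p a (v a), false), (ERVar.r (v a), true)} : Clause ERVar) ∈
        ERPHP n k := Or.inr (Or.inr (Or.inr (Or.inr (Or.inr (Or.inr (Or.inr (Or.inl
        ⟨a, v a, ha1, hak, hva.1, hva.2, rfl⟩)))))))
    have c4 : ({(ERVar.p b (v b), false), (ERVar.r (v b), true)} : Clause ERVar) ∈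
        ERPHP n k := Or.inr (Or.inr (Or.inr (Or.inr (Or.inr (Or.inr (Or.inr (Or.inl
        ⟨b, v b, hb1, hbk, hvb.1, hvb.2, rfl⟩)))))))
    have h1 := Der.cl3 (K := K) c1
    have h2 := Der.cl3 (K := K) c2
    have h3 := Der.cl2 (K := K) c3
    have h4 := Der.cl2 (K := K) c4
    have g1 := Der.res (ERVar.rr (v a) (v b)) (S := {(ERVar.r (v a), true), (ERVar.r (v b), true),
      (ERVar.q (v a) (w a), true), (ERVar.q (v b) (w b), true)}) h1 h2
      (le_of_add_eq {(ERVar.q (v a) (w a), true), (ERVar.q (v b) (w b), true)} (by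
      simp only [← Multiset.singleton_add, Multiset.insert_eq_cons, Bool.not_true, Bool.not_false]; abel))
      (le_of_add_eq {(ERVar.r (v a), true), (ERVar.r (v b), true)} (by
      simp only [← Multiset.singleton_add, Multiset.insert_eq_cons, Bool.not_false]; abel))
    have g2 := Der.res (ERVar.r (v a)) (S := {(ERVar.p a (v a), true), (ERVar.r (v b), true),
      (ERVar.q (v a) (w a), true), (ERVar.q (v b) (w b), true)}) h3 g1
      (le_of_add_eq {(ERVar.r (v b), true), (ERVar.q (v a) (w a), true),
        (ERVar.q (v b) (w b), true)} (by
      simp only [← Multiset.singleton_add, Multiset.insert_eq_cons, Bool.not_true, Bool.not_false]; abel))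
      (le_of_add_eq {(ERVar.p a (v a), true)} (by
      simp only [← Multiset.singleton_add, Multiset.insert_eq_cons]; abel))
    have g3 := Der.res (ERVar.r (v b)) (S := {(ERVar.p a (v a), true), (ERVar.p b (v b), true),
      (ERVar.q (v a) (w a), true), (ERVar.q (v b) (w b), true)}) h4 g2
      (le_of_add_eq {(ERVar.p a (v a), true), (ERVar.q (v a) (w a), true),
        (ERVar.q (v b) (w b), true)} (by
      simp only [← Multiset.singleton_add, Multiset.insert_eq_cons, Bool.not_true, Bool.not_false]; abel))
      (le_of_add_eq {(ERVar.p b (v b), true)} (by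
      simp only [← Multiset.singleton_add, Multiset.insert_eq_cons]; abel))
    have g4 := g3.weaken (B := nodeQ v w k + nodeP v k) (by
      rw [add_comm]
      refine le_trans ?_ (add_le_add hPle hQle)
      exact le_of_eq (by simp only [← Multiset.singleton_add, Multiset.insert_eq_cons]; abel))
    refine g4.mono ?_
    rw [hcard]
    simp
    omega

lemma treeQ {n k : ℕ} (hk : 4 ≤ k) {v : ℕ → ℕ} (hv : ∀ u, 1 ≤ u → u ≤ k → 1 ≤ v u ∧ v u ≤ n)
    (j : ℕ) : j ≤ k → ∀ w : ℕ → ℕ, (∀ u, 1 ≤ u → u ≤ k - j → 1 ≤ w u ∧ w u ≤ k - 1) →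
    ∃ c, Der K (ERPHP n k) (mon K (nodeQ v w (k - j) + nodeP v k)) c ∧
      c + 63 * k ≤ (k - 1) ^ j * (90 * k) := by
  induction j with
  | zero =>
    intro _ w hw
    exact ⟨27 * k, leafDer hk hv hw, by simp; omega⟩
  | succ j ih =>
    intro hj w hw
    have key : ∀ x, 1 ≤ x → x ≤ k - 1 → Der K (ERPHP n k)
        (mon K ((ERVar.q (v (k - (j + 1) + 1)) x, true) ::ₘ (nodeQ v w (k - (j + 1)) + nodeP v k)))
          ((k - 1) ^ j * (90 * k) - 63 * k) := by
      intro x hx1 hx2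
      obtain ⟨c, hc, hcb⟩ := ih (by omega) (Function.update w (k - (j + 1) + 1) x) (by
        intro u hu1 hu2
        by_cases hu : u = k - (j + 1) + 1
        · subst hu; simp; omega
        · rw [Function.update_of_ne hu]; exact hw u hu1 (by omega))
      have e : nodeQ v (Function.update w (k - (j + 1) + 1) x) (k - j) =
          (ERVar.q (v (k - (j + 1) + 1)) x, true) ::ₘ nodeQ v w (k - (j + 1)) := by
        rw [show k - j = k - (j + 1) + 1 by omega, nodeQ, Function.update_self]
        congr 1
        exact nodeQ_congr (fun u hu => Function.update_of_ne (by omega) _ _)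
      rw [e, Multiset.cons_add] at hc
      exact hc.mono (by omega)
    have := branchQ (u := k - (j + 1) + 1) hk (by omega) (by omega) (hv _ (by omega) (by omega)).1
      (hv _ (by omega) (by omega)).2
      (Multiset.mem_add.2 (Or.inr (mem_nodeP (v := v) (i := k) (by omega) (by omega)))) key
    refine ⟨_, this, ?_⟩
    rw [Multiset.card_add, card_nodeP, card_nodeQ]
    have hle : 63 * k ≤ (k - 1) ^ j * (90 * k) := by
      have : 1 ≤ (k - 1) ^ j := Nat.one_le_pow _ _ (by omega)
      nlinarith
    obtain ⟨T, hT⟩ := Nat.exists_eq_add_of_le hle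
    rw [pow_succ, mul_right_comm, hT, Nat.add_sub_cancel_left]
    obtain ⟨b, rfl⟩ := Nat.exists_eq_add_of_le hk
    have : 15 * (4 + b - (j + 1) + (4 + b)) + 45 ≤ 42 * (4 + b) := by omega
    rw [show 4 + b - 1 = 3 + b by omega]
    nlinarith

lemma treeP {n k : ℕ} (hk : 4 ≤ k) (hn : 4 ≤ n) {R : ℕ} (hR : 63 * k ≤ R)
    (hbase : ∀ v : ℕ → ℕ, (∀ u, 1 ≤ u → u ≤ k → 1 ≤ v u ∧ v u ≤ n) →
      ∃ c, Der K (ERPHP n k) (mon K (nodeP v k)) c ∧ c + 63 * k ≤ R)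
    (j : ℕ) : j ≤ k → ∀ v : ℕ → ℕ, (∀ u, 1 ≤ u → u ≤ k - j → 1 ≤ v u ∧ v u ≤ n) →
    ∃ c, Der K (ERPHP n k) (mon K (nodeP v (k - j))) c ∧
      c + 63 * k ≤ n ^ j * R := by
  induction j with
  | zero =>
    intro _ v hv
    simpa using hbase v hv
  | succ j ih =>
    intro hj w hw
    have key : ∀ x, 1 ≤ x → x ≤ n → Der K (ERPHP n k)
        (mon K ((ERVar.p (k - (j + 1) + 1) x, true) ::ₘ nodeP w (k - (j + 1))))
          (n ^ j * R - 63 * k) := by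
      intro x hx1 hx2
      obtain ⟨c, hc, hcb⟩ := ih (by omega) (Function.update w (k - (j + 1) + 1) x) (by
        intro u hu1 hu2
        by_cases hu : u = k - (j + 1) + 1
        · subst hu; simp; omega
        · rw [Function.update_of_ne hu]; exact hw u hu1 (by omega))
      have e : nodeP (Function.update w (k - (j + 1) + 1) x) (k - j) =
          (ERVar.p (k - (j + 1) + 1) x, true) ::ₘ nodeP w (k - (j + 1)) := by
        rw [show k - j = k - (j + 1) + 1 by omega, nodeP, Function.update_self]
        congr 1
        exact nodeP_congr (fun u hu => Function.update_of_ne (by omega) _ _)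
      rw [e] at hc
      exact hc.mono (by omega)
    have := branchP (u := k - (j + 1) + 1) hn (by omega) (by omega) key
    refine ⟨_, this, ?_⟩
    rw [card_nodeP]
    have hle : 63 * k ≤ n ^ j * R := by
      have : 1 ≤ n ^ j := Nat.one_le_pow _ _ (by omega)
      nlinarith
    obtain ⟨T, hT⟩ := Nat.exists_eq_add_of_le hle
    rw [pow_succ, mul_right_comm, hT, Nat.add_sub_cancel_left]
    have : 15 * (k - (j + 1)) + 45 ≤ 42 * k := by omega
    nlinarith

theorem upper_bound (K : Type) [Field K] (n k : ℕ) (hk : 4 ≤ k) (hn : 4 ≤ n) :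
    ∃ π : PCRRefutation K ERVar (ERPHP n k), π.size ≤ 90 * k ^ (k + 1) * n ^ k := by
  have hR : 63 * k ≤ (k - 1) ^ k * (90 * k) := by
    have : 1 ≤ (k - 1) ^ k := Nat.one_le_pow _ _ (by omega)
    nlinarith
  obtain ⟨c, hc, hcb⟩ := treeP (K := K) hk hn hR (fun v hv => by
    obtain ⟨c, h1, h2⟩ := treeQ (K := K) hk hv k le_rfl (fun _ => 1) (by intro u h1 h2; omega)
    refine ⟨c, ?_, h2⟩
    simpa [nodeQ] using h1) k le_rfl (fun _ => 1) (by intro u h1 h2; omega)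
  have hc' : Der K (ERPHP n k) 1 c := by simpa [nodeP, mon] using hc
  obtain ⟨π, hπ⟩ := hc'.refutation
  refine ⟨π, hπ.trans ?_⟩
  have h1 : (k - 1) ^ k ≤ k ^ k := Nat.pow_le_pow_left (by omega) _
  calc c ≤ n ^ k * ((k - 1) ^ k * (90 * k)) := by omega
    _ ≤ n ^ k * (k ^ k * (90 * k)) := by gcongr
    _ = 90 * k ^ (k + 1) * n ^ k := by ring

end Upper2

section Extension

set_option linter.unusedSectionVars false

variable {K P H : Type} [Field K] [Fintype P] [DecidableEq P] [Fintype H] [DecidableEq H]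

/-- Domain of a partial assignment. -/
def dom (a : P → Option H) : Finset P := Finset.univ.filter (fun u => (a u).isSome)

/-- Injective partial assignments with image in `N`. -/
def Good (N : Finset H) (a : P → Option H) : Prop :=
  (∀ u w, a u = some w → w ∈ N) ∧ (∀ u u' w, a u = some w → a u' = some w → u = u')

abbrev put (a : P → Option H) (u : P) (w : H) : P → Option H := Function.update a u (some w)

lemma mem_dom {a : P → Option H} {u : P} : u ∈ dom a ↔ ∃ w, a u = some w := by
  simp [dom, Option.isSome_iff_exists]

lemma not_mem_dom {a : P → Option H} {u : P} : u ∉ dom a ↔ a u = none := by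
  simp [dom]

lemma dom_put (a : P → Option H) (u : P) (w : H) : dom (put a u w) = insert u (dom a) := by
  ext x
  by_cases hx : x = u
  · subst hx; simp [mem_dom]
  · simp [mem_dom, hx]

lemma dom_del (a : P → Option H) (u : P) : dom (Function.update a u none) = (dom a).erase u := by
  ext x
  by_cases hx : x = u
  · subst hx; simp [mem_dom]
  · simp [mem_dom, hx]

lemma put_comm {u u' : P} (h : u ≠ u') (a : P → Option H) (w w' : H) :
    put (put a u w) u' w' = put (put a u' w') u w := by
  unfold put; rw [Function.update_comm h]

lemma Good.of_put {N : Finset H} {a : P → Option H} {u : P} {w : H} (hu : a u = none)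
    (h : Good N (put a u w)) : Good N a := by
  constructor
  · intro x c hx
    have hxu : x ≠ u := by rintro rfl; simp [hu] at hx
    exact h.1 x c (by simp [put, hxu, hx])
  · intro x x' c hx hx'
    have hxu : x ≠ u := by rintro rfl; simp [hu] at hx
    have hxu' : x' ≠ u := by rintro rfl; simp [hu] at hx'
    exact h.2 x x' c (by simp [put, hxu, hx]) (by simp [put, hxu', hx'])

def Supp (N : Finset H) (z : (P → Option H) → K) : Prop := ∀ a, ¬ Good N a → z a = 0

structure Sys (D : Finset P) (N : Finset H) (z : (P → Option H) → K) : Prop where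
  supp : Supp N z
  cons : ∀ b u u', u ∈ D → u' ∈ D → u ≠ u' → dom b = (D.erase u).erase u' →
    ∑ w, z (put b u w) = ∑ w, z (put b u' w)

def Solvable (D : Finset P) (N : Finset H) (z : (P → Option H) → K) : Prop :=
  ∃ y : (P → Option H) → K, Supp N y ∧
    ∀ a u, u ∈ D → dom a = D.erase u → ∑ w, y (put a u w) = z a

/-- marginals -/
def marg (D : Finset P) (Y : (P → Option H) → K) (a : P → Option H) : K :=
  ∑ u ∈ D.filter (fun u => dom a = D.erase u), ∑ w, Y (put a u w)

lemma marg_eq {D : Finset P} {Y : (P → Option H) → K} {a : P → Option H} {u : P} (hu : u ∈ D)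
    (ha : dom a = D.erase u) : marg D Y a = ∑ w, Y (put a u w) := by
  unfold marg
  have : D.filter (fun u => dom a = D.erase u) = {u} := by
    ext x
    simp only [Finset.mem_filter, Finset.mem_singleton]
    constructor
    · rintro ⟨hx, h⟩
      by_contra hne
      have : x ∈ D.erase u := Finset.mem_erase.2 ⟨hne, hx⟩
      rw [← ha, h] at this
      simp at this
    · rintro rfl; exact ⟨hu, ha⟩
  rw [this, Finset.sum_singleton]

lemma marg_supp {D : Finset P} {N : Finset H} {Y : (P → Option H) → K} (hY : Supp N Y) :
    Supp N (marg D Y) := by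
  intro a ha
  unfold marg
  refine Finset.sum_eq_zero (fun u hu => Finset.sum_eq_zero (fun w _ => hY _ (fun hg => ha ?_)))
  simp only [Finset.mem_filter] at hu
  refine hg.of_put ?_
  rw [← not_mem_dom, hu.2]; simp

lemma peel {D : Finset P} {N : Finset H} {z Y : (P → Option H) → K} (hz : Sys D N z)
    (hY : Supp N Y) (Q : (P → Option H) → Prop)
    (hQ : ∀ a u, u ∈ D → dom a = D.erase u → Good N a → Q a → ∑ w, Y (put a u w) = z a) :
    ∃ z1 : (P → Option H) → K, Sys D N z1 ∧ (∀ a, Q a → z1 a = 0) ∧ (Solvable D N z1 → Solvable D N z) := by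
  classical
  refine ⟨fun a => if Q a then 0 else z a - marg D Y a, ⟨?_, ?_⟩, ?_, ?_⟩
  · intro a ha
    simp [hz.supp a ha, marg_supp hY a ha]
  · have key : ∀ a u, u ∈ D → dom a = D.erase u →
        (if Q a then 0 else z a - marg D Y a) = z a - ∑ w, Y (put a u w) := by
      intro a u hu ha
      rw [marg_eq hu ha]
      split_ifs with h
      · by_cases hg : Good N a
        · rw [hQ a u hu ha hg h, sub_self]
        · rw [hz.supp a hg, ← marg_eq hu ha, marg_supp hY a hg, sub_self]
      · rfl
    intro b u u' hu hu' hne hb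
    have d1 : ∀ w, dom (put b u w) = D.erase u' := by
      intro w
      rw [dom_put, hb, Finset.erase_right_comm, Finset.insert_erase]
      exact Finset.mem_erase.2 ⟨hne, hu⟩
    have d2 : ∀ w, dom (put b u' w) = D.erase u := by
      intro w
      rw [dom_put, hb, Finset.insert_erase]
      exact Finset.mem_erase.2 ⟨hne.symm, hu'⟩
    rw [Finset.sum_congr rfl (fun w _ => key _ u' hu' (d1 w)),
      Finset.sum_congr rfl (fun w _ => key _ u hu (d2 w)), Finset.sum_sub_distrib,
      Finset.sum_sub_distrib, hz.cons b u u' hu hu' hne hb]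
    congr 1
    rw [Finset.sum_comm]
    refine Finset.sum_congr rfl (fun w _ => Finset.sum_congr rfl (fun w' _ => ?_))
    rw [put_comm hne]
  · intro a ha; simp [ha]
  · rintro ⟨y, hy1, hy2⟩
    refine ⟨fun a => y a + Y a, fun a ha => by simp [hy1 a ha, hY a ha], ?_⟩
    intro a u hu ha
    rw [Finset.sum_add_distrib, hy2 a u hu ha]
    beta_reduce
    rw [marg_eq hu ha]
    split_ifs with h
    · by_cases hg : Good N a
      · rw [hQ a u hu ha hg h, zero_add]
      · rw [hz.supp a hg, ← marg_eq hu ha, marg_supp hY a hg, zero_add]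
    · ring

lemma link {D : Finset P} {N N' : Finset H} {z : (P → Option H) → K} (hz : Sys D N z)
    {i : P} {h : H} (hi : i ∈ D) (hh : h ∈ N) (hh' : h ∉ N') (hNN : N' ⊆ N)
    (IH : ∀ z' : (P → Option H) → K, Sys (D.erase i) N' z' → Solvable (D.erase i) N' z')
    (hN' : ∀ a, a i = none → ¬ Good N' a → z (put a i h) = 0) :
    ∃ Y : (P → Option H) → K, Supp N Y ∧ (∀ a, a i ≠ some h → Y a = 0) ∧
      (∀ a u, u ∈ D → u ≠ i → dom a = D.erase u → a i = some h → ∑ w, Y (put a u w) = z a) ∧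
      (∀ a, dom a = D.erase i → ¬ Good N' a → ∑ w, Y (put a i w) = 0) := by
  obtain ⟨y, hy1, hy2⟩ := IH (fun a => if a i = none then z (put a i h) else 0) ⟨by
    intro a ha
    by_cases hai : a i = none
    · simp [hai, hN' a hai ha]
    · simp [hai], by
    intro b u u' hu hu' hne hb
    have hui : u ≠ i := (Finset.mem_erase.1 hu).1
    have hui' : u' ≠ i := (Finset.mem_erase.1 hu').1
    have hbi : b i = none := by rw [← not_mem_dom, hb]; simp
    have e1 : ∀ w, (put b u w) i = none := by intro w; simp [put, hui.symm, hbi]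
    have e2 : ∀ w, (put b u' w) i = none := by intro w; simp [put, hui'.symm, hbi]
    simp only [e1, e2, if_true]
    simp only [put_comm hui, put_comm hui']
    refine hz.cons (put b i h) u u' (Finset.mem_of_mem_erase hu) (Finset.mem_of_mem_erase hu') hne ?_
    rw [dom_put, hb]
    ext x
    simp only [Finset.mem_insert, Finset.mem_erase]
    constructor
    · rintro (rfl | hx)
      · exact ⟨hui'.symm, hui.symm, hi⟩
      · exact ⟨hx.1, hx.2.1, hx.2.2.2⟩
    · rintro ⟨h1, h2, h3⟩
      by_cases hx : x = i
      · exact Or.inl hx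
      · exact Or.inr ⟨h1, h2, hx, h3⟩⟩
  refine ⟨fun a => if a i = some h then y (Function.update a i none) else 0, ?_, ?_, ?_, ?_⟩
  · intro a ha
    by_cases hai : a i = some h
    · simp only [hai, if_true]
      refine hy1 _ (fun hg => ha ⟨?_, ?_⟩)
      · intro u w hu
        by_cases hui : u = i
        · subst hui; rw [hai] at hu; cases hu; exact hh
        · exact hNN (hg.1 u w (by simp [hui, hu]))
      · have aux : ∀ u, a u = some h → u = i := by
          intro u hu
          by_contra hui
          exact hh' (hg.1 u h (by simp [hui, hu]))
        intro u u' w hu hu'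
        by_cases hui : u = i
        · subst hui
          rw [hai] at hu; cases hu
          exact (aux u' hu').symm
        · by_cases hui' : u' = i
          · subst hui'
            rw [hai] at hu'; cases hu'
            exact aux u hu
          · exact hg.2 u u' w (by simp [hui, hu]) (by simp [hui', hu'])
    · simp [hai]
  · intro a ha; simp [ha]
  · intro a u hu hui ha hai
    have hau : a u = none := by rw [← not_mem_dom, ha]; simp
    have e1 : ∀ w, (put a u w) i = some h := by intro w; simp [put, hui.symm, hai]
    simp only [e1, if_true]
    have e2 : ∀ w, Function.update (put a u w) i none = put (Function.update a i none) u w := by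
      intro w; unfold put; rw [Function.update_comm hui]
    simp only [e2]
    rw [hy2 _ u (Finset.mem_erase.2 ⟨hui, hu⟩) (by rw [dom_del, ha, Finset.erase_right_comm])]
    simp only [Function.update_self, if_true]
    congr 1
    unfold put
    rw [Function.update_idem, ← hai, Function.update_eq_self]
  · intro a ha hg
    have hai : a i = none := by rw [← not_mem_dom, ha]; simp
    have e2 : ∀ w, Function.update (put a i w) i none = a := by
      intro w; unfold put; rw [Function.update_idem, ← hai, Function.update_eq_self]
    refine Finset.sum_eq_zero (fun w _ => ?_)
    beta_reduce
    rw [e2, hy1 a hg, ite_self]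

lemma cone {D : Finset P} {N : Finset H} {z : (P → Option H) → K} (hz : Sys D N z)
    {u0 : P} {h : H} (hu0 : u0 ∈ D) (hh : h ∈ N)
    (h1 : ∀ a, (∃ i, i ≠ u0 ∧ a i = some h) → z a = 0)
    (h2 : ∀ a, (∃ c, c ≠ h ∧ a u0 = some c) → z a = 0) : Solvable D N z := by
  refine ⟨fun a => if a u0 = some h then z (Function.update a u0 none) else 0, ?_, ?_⟩
  · intro a ha
    by_cases hai : a u0 = some h
    · simp only [hai, if_true]
      by_cases hex : ∃ i, i ≠ u0 ∧ a i = some h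
      · obtain ⟨i, hi, hai'⟩ := hex
        exact h1 _ ⟨i, hi, by simp [hi, hai']⟩
      push Not at hex
      refine hz.supp _ (fun hg => ha ⟨?_, ?_⟩)
      · intro u w hu
        by_cases hui : u = u0
        · subst hui; rw [hai] at hu; cases hu; exact hh
        · exact hg.1 u w (by simp [hui, hu])
      · intro u u' w hu hu'
        by_cases hui : u = u0
        · subst hui
          rw [hai] at hu; cases hu
          by_contra hne
          exact hex u' (Ne.symm hne) hu'
        · by_cases hui' : u' = u0
          · subst hui'
            rw [hai] at hu'; cases hu'
            exact absurd hu (hex u hui)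
          · exact hg.2 u u' w (by simp [hui, hu]) (by simp [hui', hu'])
    · simp [hai]
  · intro a u hu ha
    have hau : a u = none := by rw [← not_mem_dom, ha]; simp
    by_cases hu' : u = u0
    · subst hu'
      have e2 : ∀ w, Function.update (put a u w) u none = a := by
        intro w; unfold put; rw [Function.update_idem, ← hau, Function.update_eq_self]
      simp only [e2]
      rw [Finset.sum_eq_single h]
      · simp [put]
      · intro w _ hw; simp [put, hw]
      · simp
    · have hmem : u0 ∈ dom a := by rw [ha]; exact Finset.mem_erase.2 ⟨Ne.symm hu', hu0⟩
      obtain ⟨c, hc⟩ := mem_dom.1 hmem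
      have e1 : ∀ w, (put a u w) u0 = some c := by intro w; simp [put, Ne.symm hu', hc]
      simp only [e1]
      by_cases hch : c = h
      · subst hch
        simp only [if_true]
        have e2 : ∀ w, Function.update (put a u w) u0 none = put (Function.update a u0 none) u w := by
          intro w; unfold put; rw [Function.update_comm hu']
        simp only [e2]
        rw [hz.cons _ u u0 hu hu0 hu' (by rw [dom_del, ha])]
        rw [Finset.sum_eq_single c]
        · congr 1
          unfold put
          rw [Function.update_idem, ← hc, Function.update_eq_self]
        · intro w _ hw
          exact h2 _ ⟨w, hw, by simp [put]⟩
        · simp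
      · simp only [Option.some.injEq, hch, if_false, Finset.sum_const_zero]
        exact (h2 a ⟨c, hch, hc⟩).symm

lemma extension_local (m : ℕ) : ∀ (D : Finset P) (N : Finset H), D.card = m → 2 * m ≤ N.card + 1 →
    ∀ z : (P → Option H) → K, Sys D N z → Solvable D N z := by
  induction m with
  | zero =>
    intro D N hD _ z hz
    rw [Finset.card_eq_zero] at hD
    subst hD
    exact ⟨fun _ => 0, fun _ _ => rfl, by simp⟩
  | succ m ih =>
    intro D N hD hN z hz
    obtain ⟨u0, hu0⟩ : D.Nonempty := by rw [← Finset.card_pos]; omega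
    obtain ⟨h, hh⟩ : N.Nonempty := by rw [← Finset.card_pos]; omega
    -- step 1
    have L1 : ∀ i, ∃ Y : (P → Option H) → K, (i ∈ D.erase u0 →
        Supp N Y ∧ (∀ a, a i ≠ some h → Y a = 0) ∧
      (∀ a u, u ∈ D → u ≠ i → dom a = D.erase u → a i = some h → ∑ w, Y (put a u w) = z a) ∧
      (∀ a, dom a = D.erase i → ¬ Good (N.erase h) a → ∑ w, Y (put a i w) = 0)) := by
      intro i
      by_cases hi : i ∈ D.erase u0
      · have hiD := Finset.mem_of_mem_erase hi
        obtain ⟨Y, hY⟩ := link hz (N' := N.erase h) hiD hh (by simp) (Finset.erase_subset _ _)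
          (ih _ _ (by rw [Finset.card_erase_of_mem hiD]; omega)
            (by rw [Finset.card_erase_of_mem hh]; omega)) (by
          intro a hai hng
          refine hz.supp _ (fun hg => hng ?_)
          have hg' := hg.of_put hai
          refine ⟨fun u w hu => Finset.mem_erase.2 ⟨?_, hg'.1 u w hu⟩, hg'.2⟩
          rintro rfl
          have hui : u ≠ i := by rintro rfl; simp [hai] at hu
          exact hui (hg.2 u i w (by simp [put, hui, hu]) (by simp [put])))
        exact ⟨Y, fun _ => hY⟩
      · exact ⟨0, fun h => absurd h hi⟩
    choose Y hY using L1
    obtain ⟨z1, hz1, hz1Q, hz1S⟩ := peel hz (Y := fun a => ∑ i ∈ D.erase u0, Y i a)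
      (fun a ha => Finset.sum_eq_zero (fun i hi => (hY i hi).1 a ha))
      (fun a => ∃ i, i ≠ u0 ∧ a i = some h) (by
        rintro a u hu ha hg ⟨i, hi, hai⟩
        have hau : a u = none := by rw [← not_mem_dom, ha]; simp
        have hiD : i ∈ D.erase u := by rw [← ha]; exact mem_dom.2 ⟨h, hai⟩
        rw [Finset.sum_comm]
        rw [Finset.sum_eq_single i]
        · exact (hY i (Finset.mem_erase.2 ⟨hi, Finset.mem_of_mem_erase hiD⟩)).2.2.1 a u hu
            (Finset.mem_erase.1 hiD).1.symm ha hai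
        · intro i' hi' hne
          by_cases hui : u = i'
          · subst hui
            exact (hY u hi').2.2.2 a ha (fun hg' => by simpa using hg'.1 i h hai)
          · refine Finset.sum_eq_zero (fun w _ => (hY i' hi').2.1 _ ?_)
            intro h'
            simp only [put, Function.update_of_ne (Ne.symm hui)] at h'
            exact hne (hg.2 i' i h h' hai)
        · intro hni
          exact absurd (Finset.mem_erase.2 ⟨hi, Finset.mem_of_mem_erase hiD⟩) hni)
    apply hz1S
    -- step 2
    have L2 : ∀ c, ∃ Y : (P → Option H) → K, (c ∈ N.erase h →
        Supp N Y ∧ (∀ a, a u0 ≠ some c → Y a = 0) ∧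
      (∀ a u, u ∈ D → u ≠ u0 → dom a = D.erase u → a u0 = some c → ∑ w, Y (put a u w) = z1 a) ∧
      (∀ a, dom a = D.erase u0 → ¬ Good ((N.erase h).erase c) a → ∑ w, Y (put a u0 w) = 0)) := by
      intro c
      by_cases hc : c ∈ N.erase h
      · have hcN := Finset.mem_of_mem_erase hc
        obtain ⟨Y, hY⟩ := link hz1 (N' := (N.erase h).erase c) hu0 hcN (by simp)
          ((Finset.erase_subset _ _).trans (Finset.erase_subset _ _))
          (ih _ _ (by rw [Finset.card_erase_of_mem hu0]; omega)
            (by rw [Finset.card_erase_of_mem hc, Finset.card_erase_of_mem hh]; omega)) (by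
          intro a hai hng
          by_cases hex : ∃ i, i ≠ u0 ∧ a i = some h
          · obtain ⟨i, hi, hai'⟩ := hex
            exact hz1Q _ ⟨i, hi, by simp [put, hi, hai']⟩
          refine hz1.supp _ (fun hg => hng ?_)
          have hg' := hg.of_put hai
          refine ⟨fun u w hu => ?_, hg'.2⟩
          have hui : u ≠ u0 := by rintro rfl; simp [hai] at hu
          refine Finset.mem_erase.2 ⟨?_, Finset.mem_erase.2 ⟨?_, hg'.1 u w hu⟩⟩
          · rintro rfl
            exact hui (hg.2 u u0 w (by simp [put, hui, hu]) (by simp [put]))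
          · rintro rfl
            exact hex ⟨u, hui, hu⟩)
        exact ⟨Y, fun _ => hY⟩
      · exact ⟨0, fun h => absurd h hc⟩
    choose Y2 hY2 using L2
    obtain ⟨z2, hz2, hz2Q, hz2S⟩ := peel hz1 (Y := fun a => ∑ c ∈ N.erase h, Y2 c a)
      (fun a ha => Finset.sum_eq_zero (fun i hi => (hY2 i hi).1 a ha))
      (fun a => (∃ i, i ≠ u0 ∧ a i = some h) ∨ (∃ c, c ≠ h ∧ a u0 = some c)) (by
        intro a u hu ha hg hQ
        rw [Finset.sum_comm]
        by_cases huu : u = u0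
        · subst huu
          have hau : a u = none := by rw [← not_mem_dom, ha]; simp
          rcases hQ with ⟨i, hi, hai⟩ | ⟨c, hc, hac⟩
          · rw [hz1Q a ⟨i, hi, hai⟩]
            refine Finset.sum_eq_zero (fun c hc => ?_)
            exact (hY2 c hc).2.2.2 a ha (fun hg' => by simpa using hg'.1 i h hai)
          · simp [hau] at hac
        · have hmem : u0 ∈ dom a := by rw [ha]; exact Finset.mem_erase.2 ⟨Ne.symm huu, hu0⟩
          obtain ⟨c, hc⟩ := mem_dom.1 hmem
          have hcN : c ∈ N := hg.1 _ _ hc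
          have hzero : ∀ c' ∈ N.erase h, c' ≠ c → ∑ w, Y2 c' (put a u w) = 0 := by
            intro c' hc' hne
            refine Finset.sum_eq_zero (fun w _ => (hY2 c' hc').2.1 _ ?_)
            simp [put, Ne.symm huu, hc, Ne.symm hne]
          by_cases hch : c = h
          · subst hch
            rw [Finset.sum_eq_zero (fun c' hc' => hzero c' hc' (Finset.mem_erase.1 hc').1)]
            rcases hQ with ⟨i, hi, hai⟩ | ⟨c', hc', hac⟩
            · exact (hz1Q a ⟨i, hi, hai⟩).symm
            · rw [hc] at hac; cases hac; exact absurd rfl hc'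
          · have hcm : c ∈ N.erase h := Finset.mem_erase.2 ⟨hch, hcN⟩
            rw [Finset.sum_eq_single c hzero (fun h' => absurd hcm h')]
            exact (hY2 c hcm).2.2.1 a u hu huu ha hc)
    apply hz2S
    exact cone hz2 hu0 hh (fun a ha => hz2Q a (Or.inl ha)) (fun a ha => hz2Q a (Or.inr ha))

/-- Consistent families (up to level `d`). -/
structure Cons (d : ℕ) (φ : (P → Option H) → K) : Prop where
  inj : ∀ a u u' w, u ≠ u' → a u = some w → a u' = some w → φ a = 0
  ext : ∀ a u, (dom a).card < d → a u = none → ∑ w, φ (put a u w) = φ a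

theorem extension {d : ℕ} (hd : 2 * d + 1 ≤ Fintype.card H) {φ : (P → Option H) → K}
    (hφ : Cons d φ) : ∃ ψ : (P → Option H) → K, Cons (d + 1) ψ ∧
      ∀ a, (dom a).card ≤ d → ψ a = φ a := by
  classical
  have key : ∀ D : Finset P, ∃ y : (P → Option H) → K, D.card = d + 1 →
      (Supp Finset.univ y ∧
    ∀ a u, u ∈ D → dom a = D.erase u → ∑ w, y (put a u w) = φ a) := by
    intro D
    by_cases hD : D.card = d + 1
    · obtain ⟨y, hy⟩ := extension_local (d + 1) D Finset.univ hD
        (by rw [Finset.card_univ]; omega) φ ⟨by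
          intro a ha
          unfold Good at ha
          simp only [Finset.mem_univ, implies_true, true_and] at ha
          push Not at ha
          obtain ⟨u, u', w, h1, h2, h3⟩ := ha
          exact hφ.inj a u u' w h3 h1 h2, by
          intro b u u' hu hu' hne hb
          have hc : (dom b).card < d := by
            rw [hb, Finset.card_erase_of_mem (Finset.mem_erase.2 ⟨hne.symm, hu'⟩),
              Finset.card_erase_of_mem hu]
            have : 2 ≤ D.card := by
              rw [show (2 : ℕ) = ({u, u'} : Finset P).card by rw [Finset.card_pair hne]]
              refine Finset.card_le_card ?_
              intro x hx
              simp only [Finset.mem_insert, Finset.mem_singleton] at hx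
              rcases hx with rfl | rfl <;> assumption
            omega
          rw [hφ.ext b u hc (by rw [← not_mem_dom, hb]; simp),
            hφ.ext b u' hc (by rw [← not_mem_dom, hb]; simp)]⟩
      exact ⟨y, fun _ => hy⟩
    · exact ⟨0, fun h => absurd h hD⟩
  choose y hy using key
  refine ⟨fun a => if (dom a).card ≤ d then φ a else if (dom a).card = d + 1 then y (dom a) a else 0,
    ⟨?_, ?_⟩, ?_⟩
  · intro a u u' w hne h1 h2
    beta_reduce
    split_ifs with g1 g2
    · exact hφ.inj a u u' w hne h1 h2
    · exact (hy _ g2).1 a (fun hg => hne (hg.2 u u' w h1 h2))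
    · rfl
  · intro a u ha hau
    have hun : u ∉ dom a := not_mem_dom.2 hau
    have hc : ∀ w, (dom (put a u w)).card = (dom a).card + 1 := by
      intro w; rw [dom_put, Finset.card_insert_of_notMem hun]
    simp only [hc]
    rw [if_pos (by omega : (dom a).card ≤ d)]
    by_cases h1 : (dom a).card + 1 ≤ d
    · simp only [h1, if_true]
      exact hφ.ext a u (by omega) hau
    · have h2 : (dom a).card + 1 = d + 1 := by omega
      simp only [h2, Nat.not_succ_le_self, if_true, if_false, dom_put]
      exact (hy (insert u (dom a)) (by rw [Finset.card_insert_of_notMem hun, h2])).2 a u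
        (Finset.mem_insert_self _ _) (by rw [Finset.erase_insert hun])
  · intro a ha; simp [ha]

theorem exists_cons (d : ℕ) (hd : 2 * d ≤ Fintype.card H + 1) :
    ∃ φ : (P → Option H) → K, Cons d φ ∧ φ (fun _ => none) = 1 := by
  induction d with
  | zero =>
    refine ⟨fun a => if dom a = ∅ then 1 else 0, ⟨?_, by simp⟩, ?_⟩
    · intro a u u' w _ h _
      have : u ∈ dom a := mem_dom.2 ⟨w, h⟩
      rw [if_neg (Finset.ne_empty_of_mem this)]
    · beta_reduce
      rw [if_pos]; ext u; simp [mem_dom]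
  | succ d ih =>
    obtain ⟨φ, h1, h2⟩ := ih (by omega)
    obtain ⟨ψ, h3, h4⟩ := extension (by omega) h1
    refine ⟨ψ, h3, ?_⟩
    rw [h4, h2]
    have : dom (fun _ : P => (none : Option H)) = ∅ := by ext u; simp [mem_dom]
    simp [this]

end Extension

section DegreeBound

set_option linter.unusedSectionVars false

variable {K P H V : Type} [Field K] [Fintype P] [DecidableEq P] [Fintype H] [DecidableEq H]
  [Inhabited H] [DecidableEq V]

/-- Complete a partial assignment by a default hole. -/
def compl (a : P → Option H) (u : P) : H := (a u).getD default

/-- Pseudo-expectation on domain `U`. -/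
noncomputable def pE (φ : (P → Option H) → K) (U : Finset P) (g : (P → H) → K) : K :=
  ∑ a ∈ Finset.univ.filter (fun a : P → Option H => dom a = U), φ a * g (compl a)

lemma sum_dom_insert {U : Finset P} {u : P} (hu : u ∉ U) (F : (P → Option H) → K) :
    ∑ a ∈ Finset.univ.filter (fun a : P → Option H => dom a = insert u U), F a =
      ∑ b ∈ Finset.univ.filter (fun a : P → Option H => dom a = U), ∑ w, F (put b u w) := by
  rw [Finset.sum_sigma']
  symm
  refine Finset.sum_bij' (fun x _ => put x.1 u x.2)
    (fun a _ => ⟨Function.update a u none, (a u).getD default⟩) ?_ ?_ ?_ ?_ ?_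
  · rintro ⟨b, w⟩ hb
    simp only [Finset.mem_sigma, Finset.mem_filter, Finset.mem_univ, true_and, and_true] at hb
    simp [dom_put, hb]
  · intro a ha
    simp only [Finset.mem_filter, Finset.mem_univ, true_and] at ha
    simp [dom_del, ha, Finset.erase_insert hu]
  · rintro ⟨b, w⟩ hb
    simp only [Finset.mem_sigma, Finset.mem_filter, Finset.mem_univ, true_and, and_true] at hb
    have hbu : b u = none := by rw [← not_mem_dom, hb]; exact hu
    have e2 : Function.update (put b u w) u none = b := by
      unfold put; rw [Function.update_idem, ← hbu, Function.update_eq_self]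
    simp only [e2]
    simp [put]
  · intro a ha
    simp only [Finset.mem_filter, Finset.mem_univ, true_and] at ha
    have : u ∈ dom a := by rw [ha]; simp
    obtain ⟨w, hw⟩ := mem_dom.1 this
    simp only [put, hw, Option.getD_some, Function.update_idem]
    rw [← hw, Function.update_eq_self]
  · intro _ _; rfl

/-- `g` depends only on `U`. -/
def Junta (U : Finset P) (g : (P → H) → K) : Prop :=
  ∀ σ τ : P → H, (∀ u ∈ U, σ u = τ u) → g σ = g τ

lemma pE_insert {d : ℕ} {φ : (P → Option H) → K} (hφ : Cons d φ) {U : Finset P} {u : P}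
    (hu : u ∉ U) (hU : U.card < d) {g : (P → H) → K} (hg : Junta U g) :
    pE φ (insert u U) g = pE φ U g := by
  unfold pE
  rw [sum_dom_insert hu]
  refine Finset.sum_congr rfl (fun b hb => ?_)
  simp only [Finset.mem_filter, Finset.mem_univ, true_and] at hb
  have : ∀ w, g (compl (put b u w)) = g (compl b) := by
    intro w
    refine hg _ _ (fun x hx => ?_)
    have : x ≠ u := by rintro rfl; exact hu hx
    simp [compl, put, this]
  simp only [this]
  rw [← Finset.sum_mul, hφ.ext b u (by rw [hb]; exact hU) (by rw [← not_mem_dom, hb]; exact hu)]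

variable (loc : V → Option P) (ev : V × Bool → (P → H) → K)

/-- Value of a monomial. -/
noncomputable def mev (m : V × Bool →₀ ℕ) (σ : P → H) : K := m.prod (fun x e => ev x σ ^ e)

/-- Pigeons mentioned by a monomial. -/
noncomputable def Um (m : V × Bool →₀ ℕ) : Finset P :=
  m.support.biUnion (fun x => (loc x.1).toFinset)

/-- the linear functional -/
noncomputable def Lam (φ : (P → Option H) → K) : MvPolynomial (V × Bool) K →ₗ[K] K :=
  (MvPolynomial.basisMonomials (V × Bool) K).constr K (fun m => pE φ (Um loc m) (mev ev m))

lemma Lam_monomial (φ : (P → Option H) → K) (m : V × Bool →₀ ℕ) (c : K) :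
    Lam loc ev φ (monomial m c) = c * pE φ (Um loc m) (mev ev m) := by
  have h1 : Lam loc ev φ (monomial m 1) = pE φ (Um loc m) (mev ev m) := by
    unfold Lam
    have := Module.Basis.constr_basis (MvPolynomial.basisMonomials (V × Bool) K) K
      (fun m => pE φ (Um loc m) (mev ev m)) m
    rwa [MvPolynomial.coe_basisMonomials] at this
  have : (monomial m c : MvPolynomial (V × Bool) K) = c • monomial m 1 := by
    rw [smul_monomial, smul_eq_mul, mul_one]
  rw [this, map_smul, h1, smul_eq_mul]

lemma mev_add (m m' : V × Bool →₀ ℕ) (σ : P → H) : mev ev (m + m') σ = mev ev m σ * mev ev m' σ := by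
  unfold mev
  exact Finsupp.prod_add_index' (by simp) (by intros; rw [pow_add])

lemma mev_single (x : V × Bool) (e : ℕ) (σ : P → H) : mev ev (Finsupp.single x e) σ = ev x σ ^ e := by
  unfold mev; rw [Finsupp.prod_single_index]; simp

lemma mev_zero (σ : P → H) : mev ev 0 σ = 1 := by
  unfold mev; simp

lemma Um_add (m m' : V × Bool →₀ ℕ) : Um loc (m + m') = Um loc m ∪ Um loc m' := by
  ext u
  simp only [Um, Finset.mem_biUnion, Finset.mem_union, Finsupp.mem_support_iff, Finsupp.add_apply,
    ne_eq, Nat.add_eq_zero_iff]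
  constructor
  · rintro ⟨x, hx, hu⟩
    by_cases h : m x = 0
    · exact Or.inr ⟨x, fun h' => hx ⟨h, h'⟩, hu⟩
    · exact Or.inl ⟨x, h, hu⟩
  · rintro (⟨x, hx, hu⟩ | ⟨x, hx, hu⟩)
    · exact ⟨x, fun h => hx h.1, hu⟩
    · exact ⟨x, fun h => hx h.2, hu⟩

lemma Um_single (x : V × Bool) {e : ℕ} (he : e ≠ 0) :
    Um loc (Finsupp.single x e) = (loc x.1).toFinset := by
  unfold Um
  rw [Finsupp.support_single_ne_zero _ he, Finset.singleton_biUnion]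

lemma Um_zero : Um loc (0 : V × Bool →₀ ℕ) = ∅ := by
  simp [Um]

lemma junta_mev (hloc : ∀ x σ τ, (∀ u, loc x.1 = some u → σ u = τ u) → ev x σ = ev x τ)
    (m : V × Bool →₀ ℕ) : Junta (Um loc m) (mev ev m) := by
  intro σ τ h
  unfold mev
  refine Finsupp.prod_congr (fun x hx => ?_)
  rw [hloc x σ τ]
  intro u hu
  exact h u (Finset.mem_biUnion.2 ⟨x, hx, by simp [hu]⟩)

/-- restrict `φ` by multiplying with a function of pigeon `u` -/
noncomputable def twist (φ : (P → Option H) → K) (u : P) (ξ : H → K) (b : P → Option H) : K :=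
  match b u with
  | some w => ξ w * φ b
  | none => ∑ w, ξ w * φ (put b u w)

lemma twist_some {φ : (P → Option H) → K} {u : P} {ξ : H → K} {b : P → Option H} {w : H}
    (h : b u = some w) : twist φ u ξ b = ξ w * φ b := by
  unfold twist; rw [h]

lemma twist_none {φ : (P → Option H) → K} {u : P} {ξ : H → K} {b : P → Option H}
    (h : b u = none) : twist φ u ξ b = ∑ w, ξ w * φ (put b u w) := by
  unfold twist; rw [h]

lemma twist_cons {d : ℕ} {φ : (P → Option H) → K} (hφ : Cons (d + 1) φ) (u : P) (ξ : H → K) :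
    Cons d (twist φ u ξ) := by
  constructor
  · intro a x x' w hne h1 h2
    cases hau : a u with
    | some c => rw [twist_some hau, hφ.inj a x x' w hne h1 h2, mul_zero]
    | none =>
      rw [twist_none hau]
      refine Finset.sum_eq_zero (fun c _ => ?_)
      have hx : x ≠ u := by rintro rfl; simp [hau] at h1
      have hx' : x' ≠ u := by rintro rfl; simp [hau] at h2
      rw [hφ.inj _ x x' w hne (by simp [put, hx, h1]) (by simp [put, hx', h2]), mul_zero]
  · intro b x hb hbx
    by_cases hxu : x = u
    · subst hxu
      rw [twist_none hbx]
      refine Finset.sum_congr rfl (fun w _ => ?_)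
      rw [twist_some (w := w) (by simp [put])]
    · cases hbu : b u with
      | some c =>
        rw [twist_some hbu, ← hφ.ext b x (by omega) hbx, Finset.mul_sum]
        refine Finset.sum_congr rfl (fun w _ => ?_)
        rw [twist_some (w := c) (by simp [put, Ne.symm hxu, hbu])]
      | none =>
        rw [twist_none hbu]
        have : ∀ w, twist φ u ξ (put b x w) = ∑ c, ξ c * φ (put (put b u c) x w) := by
          intro w
          rw [twist_none (by simp [put, Ne.symm hxu, hbu])]
          simp only [put_comm hxu]
        simp only [this]
        rw [Finset.sum_comm]
        refine Finset.sum_congr rfl (fun c _ => ?_)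
        rw [← Finset.mul_sum, hφ.ext _ x _ (by simp [put, hxu, hbx])]
        rw [dom_put]
        have := Finset.card_insert_le u (dom b)
        omega

lemma pE_twist {φ : (P → Option H) → K} (u : P) (ξ : H → K) {U : Finset P} {g : (P → H) → K}
    (hg : Junta U g) :
    pE φ (insert u U) (fun σ => ξ (σ u) * g σ) = pE (twist φ u ξ) U g := by
  unfold pE
  by_cases hu : u ∈ U
  · rw [Finset.insert_eq_of_mem hu]
    refine Finset.sum_congr rfl (fun a ha => ?_)
    simp only [Finset.mem_filter, Finset.mem_univ, true_and] at ha
    obtain ⟨w, hw⟩ := mem_dom.1 (ha ▸ hu : u ∈ dom a)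
    rw [twist_some hw]
    simp only [compl, hw, Option.getD_some]
    ring
  · rw [sum_dom_insert hu]
    refine Finset.sum_congr rfl (fun b hb => ?_)
    simp only [Finset.mem_filter, Finset.mem_univ, true_and] at hb
    have hbu : b u = none := by rw [← not_mem_dom, hb]; exact hu
    rw [twist_none hbu, Finset.sum_mul]
    refine Finset.sum_congr rfl (fun w _ => ?_)
    have h1 : g (compl (put b u w)) = g (compl b) := by
      refine hg _ _ (fun x hx => ?_)
      have : x ≠ u := by rintro rfl; exact hu hx
      simp [compl, put, this]
    have h2 : compl (put b u w) u = w := by simp [compl, put]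
    beta_reduce
    rw [h1, h2]
    ring

theorem no_narrow {F : Set (Clause V)} (π : PCRRefutation K V F)
    (hloc : ∀ x σ τ, (∀ u, loc x.1 = some u → σ u = τ u) → ev x σ = ev x τ)
    (hbool : ∀ x σ, ev x σ = 0 ∨ ev x σ = 1)
    (hcomp : ∀ v σ, ev (v, false) σ + ev (v, true) σ = 1)
    (hC : ∀ C ∈ F, ∀ σ, (∃ l ∈ C, ev (l.1, !l.2) σ = 0) ∨
      ∃ l ∈ C, ∃ l' ∈ C, ∃ u u', loc l.1 = some u ∧ loc l'.1 = some u' ∧ u ≠ u' ∧ σ u = σ u')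
    (d : ℕ) (hd : 2 * d + 1 ≤ Fintype.card H)
    (hgood : ∀ p ∈ π.lines, ∀ m ∈ p.support, (Um loc m).card ≤ d ∨ ∀ σ, mev ev m σ = 0) : False := by
  have main : ∀ (t : ℕ) (p : MvPolynomial (V × Bool) K), π.lines[t]? = some p →
      ∀ φ : (P → Option H) → K, Cons (d + 1) φ → Lam loc ev φ p = 0 := by
    intro t
    induction t using Nat.strong_induction_on with
    | _ t ih =>
    intro p hp φ hφ
    rcases π.valid t p hp with ⟨x, rfl⟩ | ⟨v, rfl⟩ | ⟨C, hCF, rfl⟩ |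
      ⟨i, j, hi, hj, a, b, pi, pj, hpi, hpj, rfl⟩ | ⟨i, hi, x, pi, hpi, rfl⟩
    · rw [map_sub, X_pow_eq_monomial, Lam_monomial, X, Lam_monomial, Um_single _ _ (by norm_num),
        Um_single _ _ (by norm_num)]
      rw [show mev ev (Finsupp.single x 2) = mev ev (Finsupp.single x 1) by
        funext σ
        rw [mev_single, mev_single]
        rcases hbool x σ with h | h <;> simp [h]]
      rw [sub_self]
    · have h0 : Lam loc ev φ 1 = pE φ ∅ (fun _ => 1) := by
        have : (1 : MvPolynomial (V × Bool) K) = monomial 0 1 := rfl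
        rw [this, Lam_monomial, Um_zero, one_mul]
        congr 1
      have h1 : pE φ ∅ (fun _ => (1 : K)) = pE φ (loc v).toFinset (fun _ => 1) := by
        cases h : loc v with
        | none => simp
        | some u =>
          rw [Option.toFinset_some, ← insert_empty_eq]
          exact (pE_insert hφ (by simp) (by simp) (fun _ _ _ => rfl)).symm
      rw [map_sub, map_sub, h0, X, X, Lam_monomial, Lam_monomial, Um_single _ _ (by norm_num),
        Um_single _ _ (by norm_num), h1, one_mul, one_mul]
      unfold pE
      rw [← Finset.sum_sub_distrib, ← Finset.sum_sub_distrib]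
      refine Finset.sum_eq_zero (fun a _ => ?_)
      rw [mev_single, mev_single, pow_one, pow_one, ← hcomp v (compl a)]
      ring
    · have he : encodeClauseMono K C =
          monomial (∑ l ∈ C, Finsupp.single (l.1, !l.2) 1) (1 : K) := by
        unfold encodeClauseMono
        rw [MvPolynomial.monomial_sum_one]; rfl
      rw [he, Lam_monomial, one_mul]
      unfold pE
      refine Finset.sum_eq_zero (fun a ha => ?_)
      simp only [Finset.mem_filter, Finset.mem_univ, true_and] at ha
      have hmem : ∀ l ∈ C, (l.1, !l.2) ∈ (∑ l ∈ C, Finsupp.single (l.1, !l.2) 1 : V × Bool →₀ ℕ).support := by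
        intro l hl
        rw [Finsupp.mem_support_iff, Finsupp.finsetSum_apply]
        intro h0
        rw [Finset.sum_eq_zero_iff] at h0
        simpa using h0 l hl
      rcases hC C hCF (compl a) with ⟨l, hl, h0⟩ | ⟨l, hl, l', hl', u, u', hu, hu', hne, hcol⟩
      · have : mev ev (∑ l ∈ C, Finsupp.single (l.1, !l.2) 1) (compl a) = 0 := by
          unfold mev
          refine Finset.prod_eq_zero (hmem l hl) ?_
          beta_reduce
          rw [h0, zero_pow]
          exact Finsupp.mem_support_iff.1 (hmem l hl)
        rw [this, mul_zero]
      · have m1 : u ∈ dom a := by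
          rw [ha]; exact Finset.mem_biUnion.2 ⟨_, hmem l hl, by simp [hu]⟩
        have m2 : u' ∈ dom a := by
          rw [ha]; exact Finset.mem_biUnion.2 ⟨_, hmem l' hl', by simp [hu']⟩
        obtain ⟨w, hw⟩ := mem_dom.1 m1
        obtain ⟨w', hw'⟩ := mem_dom.1 m2
        simp only [compl, hw, hw', Option.getD_some] at hcol
        subst hcol
        rw [hφ.inj a u u' w hne hw hw', zero_mul]
    · rw [map_add, map_smul, map_smul, ih i hi pi hpi φ hφ, ih j hj pj hpj φ hφ]
      simp
    · have hgi := hgood pi (List.mem_of_getElem? hpi)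
      have hexp : ∀ χ : (P → Option H) → K, Lam loc ev χ pi =
          ∑ m ∈ pi.support, coeff m pi * pE χ (Um loc m) (mev ev m) := by
        intro χ
        conv_lhs => rw [pi.as_sum]
        rw [map_sum]
        exact Finset.sum_congr rfl (fun m _ => Lam_monomial loc ev χ m _)
      have hexpx : Lam loc ev φ (X x * pi) =
          ∑ m ∈ pi.support, coeff m pi *
            pE φ ((loc x.1).toFinset ∪ Um loc m) (fun σ => ev x σ * mev ev m σ) := by
        conv_lhs => rw [pi.as_sum]
        rw [Finset.mul_sum, map_sum]
        refine Finset.sum_congr rfl (fun m _ => ?_)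
        rw [X, monomial_mul, one_mul, Lam_monomial, Um_add, Um_single _ _ one_ne_zero]
        congr 2
        funext σ
        rw [mev_add, mev_single, pow_one]
      rw [hexpx]
      cases hx : loc x.1 with
      | none =>
        have hc : ∀ σ, ev x σ = ev x (fun _ => default) := fun σ => hloc x _ _ (by simp [hx])
        have := ih i hi pi hpi φ hφ
        rw [hexp] at this
        have e : ∀ m, pE φ ((none : Option P).toFinset ∪ Um loc m) (fun σ => ev x σ * mev ev m σ) =
            ev x (fun _ => default) * pE φ (Um loc m) (mev ev m) := by
          intro m
          simp only [Option.toFinset_none, Finset.empty_union]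
          unfold pE
          rw [Finset.mul_sum]
          refine Finset.sum_congr rfl (fun a _ => ?_)
          beta_reduce
          rw [hc (compl a)]; ring
        simp only [e]
        calc _ = ev x (fun _ => default) *
              ∑ m ∈ pi.support, coeff m pi * pE φ (Um loc m) (mev ev m) := by
              rw [Finset.mul_sum]; exact Finset.sum_congr rfl (fun m _ => by ring)
          _ = 0 := by rw [this, mul_zero]
      | some u =>
        obtain ⟨ψ, hψ, hψe⟩ := extension hd (twist_cons hφ u (fun w => ev x (fun _ => w)))
        have := ih i hi pi hpi ψ hψ
        rw [hexp] at this
        rw [← this]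
        refine Finset.sum_congr rfl (fun m hm => ?_)
        congr 1
        rcases hgi m hm with h | h
        · have hxe : ∀ σ, ev x σ = (fun w => ev x (fun _ => w)) (σ u) := by
            intro σ
            refine hloc x _ _ (fun u' hu' => ?_)
            rw [hx] at hu'; cases hu'; rfl
          have e2 : pE ψ (Um loc m) (mev ev m) =
              pE (twist φ u (fun w => ev x (fun _ => w))) (Um loc m) (mev ev m) := by
            unfold pE
            refine Finset.sum_congr rfl (fun a ha => ?_)
            simp only [Finset.mem_filter, Finset.mem_univ, true_and] at ha
            rw [hψe a (by rw [ha]; exact h)]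
          rw [e2, ← pE_twist u _ (junta_mev loc ev hloc m), Option.toFinset_some,
            Finset.singleton_union]
          congr 1
          funext σ
          rw [hxe σ]
        · simp [pE, h]
  obtain ⟨φ, hφ, hφ1⟩ := exists_cons (K := K) (P := P) (H := H) (d + 1) (by omega)
  have hlast := main (π.lines.length - 1) 1 (by
    rw [← π.last_one, List.getLast_eq_getElem]
    exact List.getElem?_eq_getElem _) φ hφ
  have h0 : (1 : MvPolynomial (V × Bool) K) = monomial 0 1 := rfl
  rw [h0, Lam_monomial, Um_zero, one_mul] at hlast
  unfold pE at hlast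
  rw [Finset.sum_eq_single (fun _ => none)] at hlast
  · rw [hφ1, mev_zero] at hlast; simp at hlast
  · intro b hb hne
    simp only [Finset.mem_filter, Finset.mem_univ, true_and] at hb
    exfalso; apply hne; funext u
    rw [← not_mem_dom, hb]; simp
  · intro h
    exfalso; apply h
    simp only [Finset.mem_filter, Finset.mem_univ, true_and]
    ext u; simp [mem_dom]

end DegreeBound

section ERPHPLower

open Classical in
/-- Partial inverse of `f`. -/
noncomputable def finv {k n : ℕ} (f : Fin k → Fin (n + 1)) (v : ℕ) : Option (Fin k) :=
  if h : ∃ u, (f u : ℕ) = v then some h.choose else none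

lemma finv_some {k n : ℕ} {f : Fin k → Fin (n + 1)} (hf : Function.Injective f) {v : ℕ} {u : Fin k} :
    finv f v = some u ↔ (f u : ℕ) = v := by
  unfold finv
  split_ifs with h
  · have hc := h.choose_spec
    rw [Option.some.injEq]
    constructor
    · intro e; rw [← e]; exact hc
    · intro e
      exact hf (Fin.ext (hc.trans e.symm))
  · simp only [reduceCtorEq, false_iff]
    exact fun e => h ⟨u, e⟩

lemma finv_none {k n : ℕ} {f : Fin k → Fin (n + 1)} {v : ℕ} :
    finv f v = none ↔ ∀ u, (f u : ℕ) ≠ v := by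
  unfold finv
  split_ifs with h
  · simp only [reduceCtorEq, false_iff]
    push Not
    exact h
  · simp only [true_iff]
    push Not at h
    exact h

/-- Index of the pigeon-candidate mentioned by a hole variable. -/
def vOf : ERVar → Option ℕ
  | .q v _ => some v
  | .z v _ => some v
  | _ => none

/-- coin lookup -/
def coin {n : ℕ} (b : Fin (n + 1) → Bool) (v : ℕ) : Bool :=
  if h : v < n + 1 then b ⟨v, h⟩ else false

/-- truth value of a variable -/
def asg {k n : ℕ} (f : Fin k → Fin (n + 1)) (b : Fin (n + 1) → Bool) (σ : Fin k → Fin (k - 1)) :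
    ERVar → Prop
  | .p u v => ∃ u' : Fin k, u'.val + 1 = u ∧ (f u' : ℕ) = v
  | .q v w => (∃ u, finv f v = some u ∧ (σ u).val + 1 = w) ∨ (finv f v = none ∧ coin b v = true)
  | .r v => ∃ u, finv f v = some u
  | .rr v v' => (∃ u, finv f v = some u) ∧ (∃ u, finv f v' = some u)
  | .y u v => ∃ u' : Fin k, u'.val + 1 = u ∧ v < (f u' : ℕ)
  | .z v w => (∃ u, finv f v = some u ∧ w < (σ u).val + 1) ∨ (finv f v = none ∧ coin b v = true)

/-- pigeon of a variable -/
noncomputable def erloc {k n : ℕ} (f : Fin k → Fin (n + 1)) (x : ERVar) : Option (Fin k) :=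
  (vOf x).bind (finv f)

open Classical in
/-- value of a PCR variable -/
noncomputable def erev (K : Type) [Field K] {k n : ℕ} (f : Fin k → Fin (n + 1))
    (b : Fin (n + 1) → Bool) (x : ERVar × Bool) (σ : Fin k → Fin (k - 1)) : K :=
  if (asg f b σ x.1 ↔ x.2 = true) then 1 else 0

lemma erev_lit (K : Type) [Field K] {k n : ℕ} (f : Fin k → Fin (n + 1))
    (b : Fin (n + 1) → Bool) (σ : Fin k → Fin (k - 1)) (x : ERVar) (s : Bool)
    (h : asg f b σ x ↔ s = true) : erev K f b (x, !s) σ = 0 := by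
  unfold erev
  rw [if_neg]
  cases s <;> simp_all

lemma asg_loc {k n : ℕ} (f : Fin k → Fin (n + 1)) (b : Fin (n + 1) → Bool)
    (σ τ : Fin k → Fin (k - 1)) (x : ERVar) (h : ∀ u, erloc f x = some u → σ u = τ u) :
    asg f b σ x ↔ asg f b τ x := by
  cases x with
  | q v w =>
    simp only [erloc, vOf, Option.bind_some] at h
    simp only [asg]
    cases hv : finv f v with
    | none => simp
    | some u => simp [h u hv]
  | z v w =>
    simp only [erloc, vOf, Option.bind_some] at h
    simp only [asg]
    cases hv : finv f v with
    | none => simp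
    | some u => simp [h u hv]
  | _ => exact Iff.rfl

lemma er_clause (K : Type) [Field K] {k n : ℕ} (hk : 4 ≤ k) (f : Fin k → Fin (n + 1))
    (hf : Function.Injective f) (hf1 : ∀ u, 1 ≤ (f u : ℕ)) (b : Fin (n + 1) → Bool)
    (C : Clause ERVar) (hC : C ∈ ERPHP n k) (σ : Fin k → Fin (k - 1)) :
    (∃ l ∈ C, erev K f b (l.1, !l.2) σ = 0) ∨
      ∃ l ∈ C, ∃ l' ∈ C, ∃ u u', erloc f l.1 = some u ∧ erloc f l'.1 = some u' ∧ u ≠ u' ∧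
        σ u = σ u' := by
  have sat : ∀ x s, (x, s) ∈ C → (asg f b σ x ↔ s = true) → ∃ l ∈ C, erev K f b (l.1, !l.2) σ = 0 :=
    fun x s hx h => ⟨(x, s), hx, erev_lit K f b σ x s h⟩
  rcases hC with ⟨u, h1, h2, rfl⟩ | ⟨u, v, h1, h2, h3, h4, rfl⟩ | ⟨u, h1, h2, rfl⟩ |
    ⟨v, h1, h2, rfl⟩ | ⟨v, w, h1, h2, h3, h4, rfl⟩ | ⟨v, h1, h2, rfl⟩ |
    ⟨u, u', v, h1, h2, h3, h4, h5, h6, h7, rfl⟩ | ⟨u, v, h1, h2, h3, h4, rfl⟩ |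
    ⟨v, v', h1, h2, h3, h4, h5, rfl⟩ | ⟨v, v', w, h1, h2, h3, h4, h5, h6, h7, rfl⟩
  · left
    have := hf1 ⟨u - 1, by omega⟩
    rcases (by omega : (f ⟨u - 1, by omega⟩ : ℕ) = 1 ∨ (f ⟨u - 1, by omega⟩ : ℕ) = 2 ∨
      2 < (f ⟨u - 1, by omega⟩ : ℕ)) with h | h | h
    · exact sat (.p u 1) true (by simp) (by simp only [iff_true]; exact ⟨⟨u - 1, by omega⟩, by simp; omega, h⟩)
    · exact sat (.p u 2) true (by simp) (by simp only [iff_true]; exact ⟨⟨u - 1, by omega⟩, by simp; omega, h⟩)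
    · exact sat (.y u 2) true (by simp) (by simp only [iff_true]; exact ⟨⟨u - 1, by omega⟩, by simp; omega, h⟩)
  · left
    by_cases hy : asg f b σ (.y u v)
    · obtain ⟨u', hu', h⟩ := hy
      rcases (by omega : (f u' : ℕ) = v + 1 ∨ v + 1 < (f u' : ℕ)) with h | h
      · exact sat (.p u (v + 1)) true (by simp) (by simp only [iff_true]; exact ⟨u', hu', h⟩)
      · exact sat (.y u (v + 1)) true (by simp) (by simp only [iff_true]; exact ⟨u', hu', h⟩)
    · exact sat (.y u v) false (by simp) (by simpa using hy)
  · left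
    by_cases hy : asg f b σ (.y u (n - 2))
    · obtain ⟨u', hu', h⟩ := hy
      have := (f u').2
      rcases (by omega : (f u' : ℕ) = n - 1 ∨ (f u' : ℕ) = n) with h | h
      · exact sat (.p u (n - 1)) true (by simp) (by simp only [iff_true]; exact ⟨u', hu', h⟩)
      · exact sat (.p u n) true (by simp) (by simp only [iff_true]; exact ⟨u', hu', h⟩)
    · exact sat (.y u (n - 2)) false (by simp) (by simpa using hy)
  · left
    by_cases hy : asg f b σ (.r v)
    · obtain ⟨u, hu⟩ := hy
      rcases (by omega : (σ u).val + 1 = 1 ∨ 1 < (σ u).val + 1) with h | h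
      · exact sat (.q v 1) true (by simp) (by simp only [iff_true]; exact Or.inl ⟨u, hu, h⟩)
      · exact sat (.z v 1) true (by simp) (by simp only [iff_true]; exact Or.inl ⟨u, hu, h⟩)
    · exact sat (.r v) false (by simp) (by simpa using hy)
  · left
    by_cases hy : asg f b σ (.z v w)
    · rcases hy with ⟨u, hu, h⟩ | h
      · rcases (by omega : (σ u).val + 1 = w + 1 ∨ w + 1 < (σ u).val + 1) with h | h
        · exact sat (.q v (w + 1)) true (by simp) (by simp only [iff_true]; exact Or.inl ⟨u, hu, h⟩)
        · exact sat (.z v (w + 1)) true (by simp) (by simp only [iff_true]; exact Or.inl ⟨u, hu, h⟩)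
      · exact sat (.q v (w + 1)) true (by simp) (by simp only [iff_true]; exact Or.inr h)
    · exact sat (.z v w) false (by simp) (by simpa using hy)
  · left
    by_cases hy : asg f b σ (.z v (k - 3))
    · rcases hy with ⟨u, hu, h⟩ | h
      · have := (σ u).2
        rcases (by omega : (σ u).val + 1 = k - 2 ∨ (σ u).val + 1 = k - 1) with h | h
        · exact sat (.q v (k - 2)) true (by simp) (by simp only [iff_true]; exact Or.inl ⟨u, hu, h⟩)
        · exact sat (.q v (k - 1)) true (by simp) (by simp only [iff_true]; exact Or.inl ⟨u, hu, h⟩)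
      · exact sat (.q v (k - 2)) true (by simp) (by simp only [iff_true]; exact Or.inr h)
    · exact sat (.z v (k - 3)) false (by simp) (by simpa using hy)
  · left
    by_cases hy : asg f b σ (.p u v)
    · by_cases hy' : asg f b σ (.p u' v)
      · exfalso
        obtain ⟨x, hx, hx'⟩ := hy
        obtain ⟨y, hy, hy'⟩ := hy'
        have : x = y := hf (Fin.ext (hx'.trans hy'.symm))
        subst this
        omega
      · exact sat (.p u' v) false (by simp) (by simpa using hy')
    · exact sat (.p u v) false (by simp) (by simpa using hy)
  · left
    by_cases hy : asg f b σ (.p u v)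
    · obtain ⟨x, hx, hx'⟩ := hy
      exact sat (.r v) true (by simp) (by simp only [iff_true]; exact ⟨x, (finv_some hf).2 hx'⟩)
    · exact sat (.p u v) false (by simp) (by simpa using hy)
  · left
    by_cases hy : asg f b σ (.r v)
    · by_cases hy' : asg f b σ (.r v')
      · exact sat (.rr v v') true (by simp) (by simp only [iff_true]; exact ⟨hy, hy'⟩)
      · exact sat (.r v') false (by simp) (by simpa using hy')
    · exact sat (.r v) false (by simp) (by simpa using hy)
  · by_cases hr : asg f b σ (.rr v v')
    · by_cases hy : asg f b σ (.q v w)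
      · by_cases hy' : asg f b σ (.q v' w)
        · right
          obtain ⟨⟨u, hu⟩, ⟨u', hu'⟩⟩ := hr
          simp only [asg, hu, hu', Option.some.injEq, exists_eq_left', reduceCtorEq, false_and,
            or_false] at hy hy'
          refine ⟨(.q v w, false), by simp, (.q v' w, false), by simp, u, u', ?_, ?_, ?_, ?_⟩
          · simpa [erloc, vOf] using hu
          · simpa [erloc, vOf] using hu'
          · rintro rfl
            rw [finv_some hf] at hu hu'
            omega
          · apply Fin.ext; omega
        · left
          exact sat (.q v' w) false (by simp) (by simpa using hy')
      · left
        exact sat (.q v w) false (by simp) (by simpa using hy)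
    · left
      exact sat (.rr v v') false (by simp) (by simpa using hr)

open Classical in
/-- candidates mentioned in a monomial -/
noncomputable def Vm (n : ℕ) (m : ERVar × Bool →₀ ℕ) : Finset (Fin (n + 1)) :=
  Finset.univ.filter (fun v => ∃ x ∈ m.support, vOf x.1 = some v.val)

open Classical in
/-- required coin -/
noncomputable def req (n : ℕ) (m : ERVar × Bool →₀ ℕ) (v : Fin (n + 1)) : Bool :=
  if h : ∃ x ∈ m.support, vOf x.1 = some v.val then h.choose.2 else false

/-- the bad event -/
def Bad {k n : ℕ} (ℓ : ℕ) (m : ERVar × Bool →₀ ℕ) (f : Fin k → Fin (n + 1))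
    (b : Fin (n + 1) → Bool) : Prop :=
  ℓ ≤ (Finset.univ.filter (fun u => f u ∈ Vm n m)).card ∧
    ∀ v ∈ Vm n m, (∀ u, f u ≠ v) → b v = req n m v

lemma kill (K : Type) [Field K] {k n : ℕ} (f : Fin k → Fin (n + 1)) (b : Fin (n + 1) → Bool)
    (m : ERVar × Bool →₀ ℕ) (v : Fin (n + 1)) (hv : v ∈ Vm n m) (hf : ∀ u, f u ≠ v)
    (hb : b v ≠ req n m v) (σ : Fin k → Fin (k - 1)) : mev (erev K f b) m σ = 0 := by
  have h : ∃ x ∈ m.support, vOf x.1 = some v.val := by simpa [Vm] using hv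
  unfold req at hb
  rw [dif_pos h] at hb
  obtain ⟨hx, hxv⟩ := h.choose_spec
  set x := h.choose with hxdef
  unfold mev
  refine Finset.prod_eq_zero hx ?_
  have hn : finv f v.val = none := finv_none.2 (fun u hu => hf u (Fin.ext hu))
  have hc : coin b v.val = b v := by unfold coin; rw [dif_pos v.2]
  have hz : asg f b σ x.1 ↔ b v = true := by
    cases hh : x.1 with
    | q v' w =>
      rw [hh] at hxv; simp only [vOf, Option.some.injEq] at hxv; subst hxv
      simp [asg, hn, hc]
    | z v' w =>
      rw [hh] at hxv; simp only [vOf, Option.some.injEq] at hxv; subst hxv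
      simp [asg, hn, hc]
    | _ => rw [hh] at hxv; simp [vOf] at hxv
  have : erev K f b x σ = 0 := by
    unfold erev
    rw [if_neg]
    rw [hz]
    intro h'
    exact hb (Bool.eq_iff_iff.2 h')
  beta_reduce
  rw [this, zero_pow]
  exact Finsupp.mem_support_iff.1 hx

theorem exists_bad (K : Type) [Field K] {k n : ℕ} (hk : 4 ≤ k)
    (π : PCRRefutation K ERVar (ERPHP n k)) (f : Fin k → Fin (n + 1))
    (hf : Function.Injective f) (hf1 : ∀ u, 1 ≤ (f u : ℕ)) (b : Fin (n + 1) → Bool) :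
    ∃ p ∈ π.lines, ∃ m ∈ p.support, Bad (k / 2) m f b := by
  by_contra hcon
  push Not at hcon
  haveI : Inhabited (Fin (k - 1)) := ⟨⟨0, by omega⟩⟩
  refine no_narrow (P := Fin k) (H := Fin (k - 1)) (erloc f) (erev K f b) π ?_ ?_ ?_
    (er_clause K hk f hf hf1 b) (k / 2 - 1) (by rw [Fintype.card_fin]; omega) ?_
  · intro x σ τ h
    unfold erev
    rw [propext (asg_loc f b σ τ x.1 h)]
  · intro x σ
    unfold erev
    split_ifs <;> simp
  · intro v σ
    unfold erev
    by_cases h : asg f b σ v <;> simp [h]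
  · intro p hp m hm
    have := hcon p hp m hm
    unfold Bad at this
    rw [not_and_or] at this
    rcases this with h | h
    · left
      have hsub : Um (erloc f) m ⊆ Finset.univ.filter (fun u => f u ∈ Vm n m) := by
        intro u hu
        obtain ⟨x, hx, hux⟩ := Finset.mem_biUnion.1 hu
        simp only [Option.mem_toFinset, Option.mem_def, erloc, Option.bind_eq_some_iff] at hux
        obtain ⟨v, hv1, hv2⟩ := hux
        rw [finv_some hf] at hv2
        simp only [Finset.mem_filter, Finset.mem_univ, true_and, Vm]
        exact ⟨x, hx, by rw [hv1, hv2]⟩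
      have := Finset.card_le_card hsub
      omega
    · right
      push Not at h
      obtain ⟨v, hv, hv1, hv2⟩ := h
      exact kill K f b m v hv hv1 hv2

end ERPHPLower

section Counting

lemma pow_le_aux (M ℓ : ℕ) (hℓ : 1 ≤ ℓ) : M ^ ℓ ≤ ℓ ^ ℓ * 2 ^ M := by
  have h1 : M ≤ ℓ * 2 ^ (M / ℓ) := by
    have h2 : M / ℓ + 1 ≤ 2 ^ (M / ℓ) := Nat.lt_two_pow_self
    have h3 : M < ℓ * (M / ℓ + 1) := Nat.lt_mul_div_succ M (by omega)
    exact h3.le.trans (Nat.mul_le_mul_left _ h2)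
  calc M ^ ℓ ≤ (ℓ * 2 ^ (M / ℓ)) ^ ℓ := Nat.pow_le_pow_left h1 _
    _ = ℓ ^ ℓ * 2 ^ (M / ℓ * ℓ) := by rw [mul_pow, pow_mul]
    _ ≤ ℓ ^ ℓ * 2 ^ M :=
      Nat.mul_le_mul_left _ (Nat.pow_le_pow_right (by norm_num) (Nat.div_mul_le_self M ℓ))

lemma card_coins {N : ℕ} (T : Finset (Fin N)) (s : Fin N → Bool) :
    (Finset.univ.filter (fun b : Fin N → Bool => ∀ v ∈ T, b v = s v)).card * 2 ^ T.card = 2 ^ N := by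
  have h : Finset.univ.filter (fun b : Fin N → Bool => ∀ v ∈ T, b v = s v) =
      Fintype.piFinset (fun v => if v ∈ T then {s v} else Finset.univ) := by
    ext b
    simp only [Finset.mem_filter, Finset.mem_univ, true_and, Fintype.mem_piFinset]
    refine forall_congr' (fun v => ?_)
    split_ifs with hv <;> simp [hv]
  rw [h, Fintype.card_piFinset]
  have e : ∀ v, (if v ∈ T then ({s v} : Finset Bool) else Finset.univ).card =
      if v ∈ T then 1 else 2 := by
    intro v; split_ifs <;> simp
  simp only [e]
  rw [Finset.prod_ite]
  simp only [Finset.prod_const_one, one_mul, Finset.prod_const]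
  rw [← pow_add]
  congr 1
  have := Finset.card_filter_add_card_filter_not (s := (Finset.univ : Finset (Fin N))) (fun v => v ∈ T)
  rw [Finset.filter_univ_mem, Finset.card_univ, Fintype.card_fin] at this
  omega

/-- block placement -/
def blk {k n B : ℕ} (h : k * B ≤ n) (j : Fin k → Fin B) (u : Fin k) : Fin (n + 1) :=
  ⟨u * B + 1 + j u, by
    have h1 := (j u).2
    have h2 : (u.val + 1) * B ≤ k * B := Nat.mul_le_mul_right _ u.2
    rw [Nat.add_mul, one_mul] at h2
    omega⟩

lemma blk_inj {k n B : ℕ} (h : k * B ≤ n) (j : Fin k → Fin B) : Function.Injective (blk h j) := by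
  intro u u' e
  simp only [blk, Fin.mk.injEq] at e
  have h1 := (j u).2
  have h2 := (j u').2
  apply Fin.ext
  rcases lt_trichotomy u.val u'.val with hl | hl | hl
  · have := Nat.mul_le_mul_right B (Nat.succ_le_of_lt hl)
    rw [Nat.succ_mul] at this
    omega
  · exact hl
  · have := Nat.mul_le_mul_right B (Nat.succ_le_of_lt hl)
    rw [Nat.succ_mul] at this
    omega

lemma card_placements {k n B : ℕ} (h : k * B ≤ n) (V : Finset (Fin (n + 1))) (U : Finset (Fin k)) :
    (Finset.univ.filter (fun j : Fin k → Fin B => ∀ u ∈ U, blk h j u ∈ V)).card ≤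
      V.card ^ U.card * B ^ (k - U.card) := by
  let g : Fin k → Fin B → Fin (n + 1) := fun u i => blk h (fun _ => i) u
  have hs : Finset.univ.filter (fun j : Fin k → Fin B => ∀ u ∈ U, blk h j u ∈ V) =
      Fintype.piFinset (fun u => if u ∈ U then Finset.univ.filter (fun i => g u i ∈ V)
        else Finset.univ) := by
    ext b
    simp only [Finset.mem_filter, Finset.mem_univ, true_and, Fintype.mem_piFinset]
    refine forall_congr' (fun v => ?_)
    split_ifs with hv
    · simp only [hv, forall_const, Finset.mem_filter, Finset.mem_univ, true_and]
      exact Iff.rfl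
    · simp [hv]
  rw [hs, Fintype.card_piFinset]
  calc _ ≤ ∏ u : Fin k, (if u ∈ U then V.card else B) := by
        refine Finset.prod_le_prod' (fun u _ => ?_)
        split_ifs with hu
        · refine Finset.card_le_card_of_injOn (g u) ?_ ?_
          · intro i hi; simpa using hi
          · intro i _ i' _ e
            simp only [g, blk, Fin.mk.injEq] at e
            apply Fin.ext; omega
        · simp
    _ = _ := by
        rw [Finset.prod_ite]
        simp only [Finset.prod_const]
        have := Finset.card_filter_add_card_filter_not (s := (Finset.univ : Finset (Fin k)))
          (fun v => v ∈ U)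
        rw [Finset.filter_univ_mem, Finset.card_univ, Fintype.card_fin] at this
        rw [Finset.filter_univ_mem]
        congr 2
        omega

open Classical in
lemma card_bad {k n B : ℕ} (h : k * B ≤ n) (ℓ : ℕ) (hℓ : 1 ≤ ℓ) (m : ERVar × Bool →₀ ℕ) :
    (Finset.univ.filter (fun x : (Fin k → Fin B) × (Fin (n + 1) → Bool) =>
      Bad ℓ m (blk h x.1) x.2)).card ≤ 4 ^ k * ℓ ^ ℓ * B ^ (k - ℓ) * 2 ^ (n + 1) := by
  set V := Vm n m with hV
  set s := req n m with hs
  let J : Finset (Fin k) → Finset (Fin k → Fin B) := fun U =>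
    Finset.univ.filter (fun j : Fin k → Fin B => ∀ u ∈ U, blk h j u ∈ V)
  let Q : (Fin k → Fin B) → Finset (Fin (n + 1) → Bool) := fun j =>
    Finset.univ.filter (fun b => ∀ v ∈ V \ Finset.univ.image (blk h j), b v = s v)
  have hsub : Finset.univ.filter (fun x : (Fin k → Fin B) × (Fin (n + 1) → Bool) =>
      Bad ℓ m (blk h x.1) x.2) ⊆ (Finset.powersetCard ℓ (Finset.univ : Finset (Fin k))).biUnion
        (fun U => ((J U).sigma Q).image (fun x => (x.1, x.2))) := by
    rintro ⟨j, b⟩ hx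
    simp only [Finset.mem_filter, Finset.mem_univ, true_and] at hx
    obtain ⟨h1, h2⟩ := hx
    obtain ⟨U, hU, hUc⟩ := Finset.exists_subset_card_eq h1
    refine Finset.mem_biUnion.2 ⟨U, Finset.mem_powersetCard.2 ⟨Finset.subset_univ _, hUc⟩, ?_⟩
    refine Finset.mem_image.2 ⟨⟨j, b⟩, ?_, rfl⟩
    simp only [Finset.mem_sigma, J, Q, Finset.mem_filter, Finset.mem_univ, true_and]
    refine ⟨fun u hu => by simpa using hU hu, fun v hv => ?_⟩
    simp only [Finset.mem_sdiff, Finset.mem_image, Finset.mem_univ, true_and, not_exists] at hv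
    exact h2 v hv.1 hv.2
  have hQ : ∀ j, (Q j).card * 2 ^ V.card ≤ 2 ^ (n + 1) * 2 ^ k := by
    intro j
    have h1 := card_coins (V \ Finset.univ.image (blk h j)) s
    have h2 : V.card ≤ (V \ Finset.univ.image (blk h j)).card + k := by
      have h3 := Finset.le_card_sdiff (Finset.univ.image (blk h j)) V
      have h4 : (Finset.univ.image (blk h j)).card ≤ k := by
        refine Finset.card_image_le.trans ?_
        simp
      omega
    calc (Q j).card * 2 ^ V.card ≤ (Q j).card * 2 ^ ((V \ Finset.univ.image (blk h j)).card + k) :=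
          Nat.mul_le_mul_left _ (Nat.pow_le_pow_right (by norm_num) h2)
      _ = _ := by rw [pow_add, ← mul_assoc, h1]
  have hU : ∀ U ∈ Finset.powersetCard ℓ (Finset.univ : Finset (Fin k)),
      (((J U).sigma Q).image (fun x => (x.1, x.2))).card * 2 ^ V.card ≤
        V.card ^ ℓ * B ^ (k - ℓ) * (2 ^ (n + 1) * 2 ^ k) := by
    intro U hU
    have hUc := (Finset.mem_powersetCard.1 hU).2
    calc _ ≤ ((J U).sigma Q).card * 2 ^ V.card := Nat.mul_le_mul_right _ Finset.card_image_le
      _ = ∑ j ∈ J U, (Q j).card * 2 ^ V.card := by rw [Finset.card_sigma, Finset.sum_mul]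
      _ ≤ ∑ j ∈ J U, 2 ^ (n + 1) * 2 ^ k := Finset.sum_le_sum (fun j _ => hQ j)
      _ = (J U).card * (2 ^ (n + 1) * 2 ^ k) := by rw [Finset.sum_const, smul_eq_mul]
      _ ≤ _ := by
        refine Nat.mul_le_mul_right _ ?_
        have := card_placements h V U
        rw [hUc] at this
        exact this
  have hfin : (Finset.univ.filter (fun x : (Fin k → Fin B) × (Fin (n + 1) → Bool) =>
      Bad ℓ m (blk h x.1) x.2)).card * 2 ^ V.card ≤
        (4 ^ k * ℓ ^ ℓ * B ^ (k - ℓ) * 2 ^ (n + 1)) * 2 ^ V.card := by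
    calc _ ≤ (∑ U ∈ Finset.powersetCard ℓ (Finset.univ : Finset (Fin k)),
          (((J U).sigma Q).image (fun x => (x.1, x.2))).card) * 2 ^ V.card :=
          Nat.mul_le_mul_right _ ((Finset.card_le_card hsub).trans Finset.card_biUnion_le)
      _ ≤ ∑ U ∈ Finset.powersetCard ℓ (Finset.univ : Finset (Fin k)),
          V.card ^ ℓ * B ^ (k - ℓ) * (2 ^ (n + 1) * 2 ^ k) := by
          rw [Finset.sum_mul]; exact Finset.sum_le_sum hU
      _ = k.choose ℓ * (V.card ^ ℓ * B ^ (k - ℓ) * (2 ^ (n + 1) * 2 ^ k)) := by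
          rw [Finset.sum_const, Finset.card_powersetCard, smul_eq_mul, Finset.card_univ,
            Fintype.card_fin]
      _ ≤ 2 ^ k * ((ℓ ^ ℓ * 2 ^ V.card) * B ^ (k - ℓ) * (2 ^ (n + 1) * 2 ^ k)) := by
          refine Nat.mul_le_mul (Nat.choose_le_two_pow k ℓ) ?_
          exact Nat.mul_le_mul_right _ (Nat.mul_le_mul_right _ (pow_le_aux _ _ hℓ))
      _ = _ := by
          rw [show (4 : ℕ) = 2 * 2 by norm_num, mul_pow]
          ring
  exact Nat.le_of_mul_le_mul_right hfin (by positivity)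

open Classical in
lemma card_union {K Ω : Type} [Field K] [Fintype Ω] {W : Type}
    (R : (W →₀ ℕ) → Ω → Prop) (A : ℕ)
    (hR : ∀ m, (Finset.univ.filter (fun x => R m x)).card ≤ A) (l : List (MvPolynomial W K)) :
    (Finset.univ.filter (fun x => ∃ p ∈ l, ∃ m ∈ p.support, R m x)).card ≤
      (l.map (fun p => p.support.card)).sum * A := by
  induction l with
  | nil => simp
  | cons p l ih =>
    rw [List.map_cons, List.sum_cons, Nat.add_mul]
    have : Finset.univ.filter (fun x => ∃ p' ∈ p :: l, ∃ m ∈ p'.support, R m x) ⊆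
        p.support.biUnion (fun m => Finset.univ.filter (fun x => R m x)) ∪
        Finset.univ.filter (fun x => ∃ p ∈ l, ∃ m ∈ p.support, R m x) := by
      intro x hx
      simp only [Finset.mem_filter, Finset.mem_univ, true_and, List.mem_cons] at hx
      obtain ⟨p', hp' | hp', m, hm, hr⟩ := hx
      · subst hp'
        refine Finset.mem_union_left _ (Finset.mem_biUnion.2 ⟨m, hm, ?_⟩)
        simpa using hr
      · refine Finset.mem_union_right _ ?_
        simp only [Finset.mem_filter, Finset.mem_univ, true_and]
        exact ⟨p', hp', m, hm, hr⟩
    refine (Finset.card_le_card this).trans ((Finset.card_union_le _ _).trans ?_)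
    refine Nat.add_le_add ?_ ih
    refine Finset.card_biUnion_le.trans ((Finset.sum_le_sum (fun m _ => hR m)).trans ?_)
    rw [Finset.sum_const, smul_eq_mul]

theorem lower_nat (K : Type) [Field K] {k n B : ℕ} (hk : 4 ≤ k) (hB : 1 ≤ B) (h : k * B ≤ n)
    (π : PCRRefutation K ERVar (ERPHP n k)) :
    B ^ (k / 2) ≤ π.size * (4 ^ k * (k / 2) ^ (k / 2)) := by
  classical
  have h1 := card_union (K := K) (W := ERVar × Bool)
    (fun m (x : (Fin k → Fin B) × (Fin (n + 1) → Bool)) => Bad (k / 2) m (blk h x.1) x.2)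
    _ (fun m => card_bad h (k / 2) (by omega) m) π.lines
  have h2 : Finset.univ.filter (fun x : (Fin k → Fin B) × (Fin (n + 1) → Bool) =>
      ∃ p ∈ π.lines, ∃ m ∈ p.support, Bad (k / 2) m (blk h x.1) x.2) = Finset.univ := by
    refine Finset.filter_true_of_mem (fun x _ => ?_)
    exact exists_bad K hk π _ (blk_inj h x.1) (fun u => by simp [blk]; omega) x.2
  rw [h2] at h1
  simp only [Finset.card_univ, Fintype.card_prod, Fintype.card_fun, Fintype.card_fin,
    Fintype.card_bool] at h1
  change _ ≤ π.size * _ at h1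
  have hpos : 0 < B ^ (k - k / 2) * 2 ^ (n + 1) := by positivity
  refine Nat.le_of_mul_le_mul_right ?_ hpos
  calc B ^ (k / 2) * (B ^ (k - k / 2) * 2 ^ (n + 1)) = B ^ k * 2 ^ (n + 1) := by
        rw [← mul_assoc, ← pow_add]; congr 2; omega
    _ ≤ _ := h1
    _ = _ := by ring

end Counting

lemma n_ge_four (n k : ℕ) (hk : 4 ≤ k)
    (h : (k : ℝ) ≤ (n : ℝ) / (4 * Real.logb 2 (n : ℝ))) : 4 ≤ n := by
  by_contra hn
  have hk' : (4 : ℝ) ≤ k := by exact_mod_cast hk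
  rcases (by omega : n = 0 ∨ n = 1 ∨ 2 ≤ n) with rfl | rfl | h2
  · simp at h; linarith
  · simp at h; linarith
  · have h2' : (2 : ℝ) ≤ n := by exact_mod_cast h2
    have h3' : (n : ℝ) < 4 := by exact_mod_cast (by omega : n < 4)
    have hL : 1 ≤ Real.logb 2 (n : ℝ) := by
      rw [Real.le_logb_iff_rpow_le (by norm_num) (by linarith), Real.rpow_one]
      exact h2'
    rw [le_div_iff₀ (by linarith)] at h
    nlinarith

lemma lower_real (K : Type) [Field K] (n k : ℕ) (hn : 16 ≤ n) (hk : 4 ≤ k)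
    (h : (k : ℝ) ≤ (n : ℝ) / (4 * Real.logb 2 (n : ℝ)))
    (π : PCRRefutation K ERVar (ERPHP n k)) :
    1 * (n : ℝ) ^ (((k - 1) + 1) / 2) /
            ((k : ℝ) * (16 / 15 : ℝ) ^ (((k - 1) + 1) / 2) *
              (2 * (k : ℝ) * Real.logb 2 (n : ℝ)) ^ k)
          ≤ (π.size : ℝ) := by
  rw [show ((k - 1) + 1) / 2 = k / 2 by congr 1; omega]
  have hk' : (4 : ℝ) ≤ k := by exact_mod_cast hk
  have hn' : (16 : ℝ) ≤ n := by exact_mod_cast hn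
  set L := Real.logb 2 (n : ℝ) with hLdef
  have hL : 4 ≤ L := by
    rw [hLdef, Real.le_logb_iff_rpow_le (by norm_num) (by linarith)]
    norm_num
    linarith
  rw [le_div_iff₀ (by linarith)] at h
  have h16 : (16 : ℝ) * k ≤ n := by nlinarith
  have h16n : 16 * k ≤ n := by exact_mod_cast h16
  set B := n / k with hB
  have hkB : k * B ≤ n := Nat.mul_div_le n k
  have hkB2 : n < k * (B + 1) := Nat.lt_mul_div_succ n (by omega)
  have hB1 : 1 ≤ B := (Nat.one_le_div_iff (by omega)).2 (by omega)
  have hlow := lower_nat K hk hB1 hkB π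
  have hlow' : (B : ℝ) ^ (k / 2) ≤ π.size * (4 ^ k * ((k / 2 : ℕ) : ℝ) ^ (k / 2)) := by
    exact_mod_cast hlow
  have hkB3 : 15 / 16 * (n : ℝ) ≤ k * B := by
    have : (n : ℝ) < k * (B + 1) := by exact_mod_cast hkB2
    nlinarith
  have hS : (0 : ℝ) ≤ π.size := Nat.cast_nonneg _
  have hpos : (0 : ℝ) < (k : ℝ) * (16 / 15 : ℝ) ^ (k / 2) * (2 * (k : ℝ) * L) ^ k := by
    positivity
  rw [div_le_iff₀ hpos, one_mul]
  have hhalf : ((k / 2 : ℕ) : ℝ) ≤ k := by exact_mod_cast Nat.div_le_self k 2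
  have key : (15 / 16 * (n : ℝ)) ^ (k / 2) ≤ π.size * (2 * (k : ℝ) * L) ^ k := by
    calc (15 / 16 * (n : ℝ)) ^ (k / 2) ≤ (k * B : ℝ) ^ (k / 2) :=
          pow_le_pow_left₀ (by positivity) hkB3 _
      _ = (k : ℝ) ^ (k / 2) * (B : ℝ) ^ (k / 2) := mul_pow _ _ _
      _ ≤ (k : ℝ) ^ (k / 2) * (π.size * (4 ^ k * ((k / 2 : ℕ) : ℝ) ^ (k / 2))) :=
          mul_le_mul_of_nonneg_left hlow' (by positivity)
      _ ≤ (k : ℝ) ^ (k / 2) * (π.size * (4 ^ k * (k : ℝ) ^ (k / 2))) := by gcongr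
      _ = π.size * 4 ^ k * (k : ℝ) ^ (k / 2 + k / 2) := by rw [pow_add]; ring
      _ ≤ π.size * 4 ^ k * (k : ℝ) ^ k := by
          refine mul_le_mul_of_nonneg_left (pow_le_pow_right₀ (by linarith) (by omega)) (by positivity)
      _ = π.size * (4 * k : ℝ) ^ k := by rw [mul_pow]; ring
      _ ≤ π.size * (2 * (k : ℝ) * L) ^ k := by
          refine mul_le_mul_of_nonneg_left (pow_le_pow_left₀ (by positivity) ?_ _) hS
          nlinarith
  calc (n : ℝ) ^ (k / 2) = (16 / 15 : ℝ) ^ (k / 2) * (15 / 16 * (n : ℝ)) ^ (k / 2) := by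
        rw [← mul_pow]; congr 1; ring
    _ ≤ (16 / 15 : ℝ) ^ (k / 2) * (π.size * (2 * (k : ℝ) * L) ^ k) :=
        mul_le_mul_of_nonneg_left key (by positivity)
    _ = 1 * (π.size * ((16 / 15 : ℝ) ^ (k / 2) * (2 * (k : ℝ) * L) ^ k)) := by ring
    _ ≤ k * (π.size * ((16 / 15 : ℝ) ^ (k / 2) * (2 * (k : ℝ) * L) ^ k)) :=
        mul_le_mul_of_nonneg_right (by linarith) (by positivity)
    _ = _ := by ring


/-- for every field `K` and every `k = k(n) ≥ 4` with
`k ≤ n/(4·log₂ n)`, the formula `ERPHP` has a PCR refutation over `K` of size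
at most `C·k^(k+1)·n^k` for an absolute constant `C`, and there exist `c > 0`
and `n₀` such that for all `n ≥ n₀` every PCR refutation of `ERPHP` over `K`
has size at least
`c · n^⌈(k−1)/2⌉ / (k · (16/15)^⌈(k−1)/2⌉ · (2k·log₂ n)^k)`
(note `⌈(k−1)/2⌉ = ((k−1)+1)/2` with natural-number division). -/
theorem pcr_size_bounds_for_erphp :
    (∃ C : ℕ, 0 < C ∧ ∀ (K : Type) [inst : Field K] (n k : ℕ), 4 ≤ k →
      (k : ℝ) ≤ (n : ℝ) / (4 * Real.logb 2 (n : ℝ)) →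
      ∃ π : PCRRefutation K ERVar (ERPHP n k), π.size ≤ C * k ^ (k + 1) * n ^ k) ∧
    (∃ c : ℝ, 0 < c ∧ ∃ n₀ : ℕ, ∀ (K : Type) [inst : Field K] (n k : ℕ),
      n₀ ≤ n → 4 ≤ k → (k : ℝ) ≤ (n : ℝ) / (4 * Real.logb 2 (n : ℝ)) →
      ∀ π : PCRRefutation K ERVar (ERPHP n k),
        c * (n : ℝ) ^ (((k - 1) + 1) / 2) /
            ((k : ℝ) * (16 / 15 : ℝ) ^ (((k - 1) + 1) / 2) *
              (2 * (k : ℝ) * Real.logb 2 (n : ℝ)) ^ k)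
          ≤ (π.size : ℝ)) := by
  refine ⟨⟨90, by norm_num, ?_⟩, ⟨1, one_pos, 16, ?_⟩⟩
  · intro K inst n k hk h
    exact upper_bound K n k hk (n_ge_four n k hk h)
  · intro K inst n k hn hk h π
    exact lower_real K n k hn hk h π

end NarrowProofs
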